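/- arXiv:1811.10096 — 9 statements merged into one kernel-verified Lean document; each statement's English description precedes it below -/
import Mathlib

section
/- Let X be a proper metric space with X = A ∪ B, and assume the decomposition is coarsely excisive: for each R > 0 there is S > 0 such that U_R(A) ∩ U_R(B) ⊆ U_S(A ∩ B), where U_R(Z) = {x ∈ X : dist(x, Z) ≤ R}. Let Y be a metric space and let f : X → Y be a map such that the restrictions f|_A : A → Y and f|_B : B → Y are coarse. Then f : X → Y is coarse. -/
/-- A map between metric spaces is controlled if points at distance `≤ R`
are mapped to points at distance `≤ S = S(R)`. -/
def Controlled {X Y : Type*} [PseudoMetricSpace X] [PseudoMetricSpace Y] (f : X → Y) : Prop :=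
  ∀ R : ℝ, 0 < R → ∃ S : ℝ, 0 < S ∧ ∀ x y : X, dist x y ≤ R → dist (f x) (f y) ≤ S

/-- A map between metric spaces is coarse if it is controlled and preimages
of bounded sets are bounded. -/
def IsCoarseMap {X Y : Type*} [PseudoMetricSpace X] [PseudoMetricSpace Y] (f : X → Y) : Prop :=
  Controlled f ∧ ∀ B : Set Y, Bornology.IsBounded B → Bornology.IsBounded (f ⁻¹' B)

/-- The closed `R`-neighbourhood `U_R(Z)` of a subset `Z` of a metric space. -/
def nbhd {X : Type*} [PseudoMetricSpace X] (R : ℝ) (Z : Set X) : Set X :=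
  {x | ∃ z ∈ Z, dist x z ≤ R}

/-- A map that is controlled on both pieces of a coarsely excisive decomposition moves points of
different pieces at bounded distance by a bounded distance. -/
lemma exists_dist_le_of_coarsely_excisive {X Y : Type*} [PseudoMetricSpace X]
    [PseudoMetricSpace Y] {A B : Set X} {f : X → Y} {R : ℝ} (hR : 0 < R)
    (hexc : ∃ S : ℝ, 0 < S ∧ nbhd R A ∩ nbhd R B ⊆ nbhd S (A ∩ B))
    (hfA : Controlled (fun a : A => f a)) (hfB : Controlled (fun b : B => f b)) :
    ∃ S : ℝ, ∀ x ∈ A, ∀ y ∈ B, dist x y ≤ R → dist (f x) (f y) ≤ S := by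
  obtain ⟨S, hS, hsub⟩ := hexc
  obtain ⟨SA, -, hA⟩ := hfA S hS
  obtain ⟨SB, -, hB⟩ := hfB (S + R) (by positivity)
  refine ⟨SA + SB, fun x hx y hy hxy => ?_⟩
  obtain ⟨z, ⟨hzA, hzB⟩, hxz⟩ :=
    hsub ⟨⟨x, hx, by simpa using hR.le⟩, ⟨y, hy, hxy⟩⟩
  have hzy : dist z y ≤ S + R := by
    linarith [dist_triangle_left z y x]
  exact (dist_triangle (f x) (f z) (f y)).trans
    (add_le_add (hA ⟨x, hx⟩ ⟨z, hzA⟩ hxz) (hB ⟨z, hzB⟩ ⟨y, hy⟩ hzy))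

theorem coarse_of_coarse_on_coarsely_excisive_union
    {X Y : Type*} [MetricSpace X] [ProperSpace X] [MetricSpace Y]
    (A B : Set X) (hAB : A ∪ B = Set.univ)
    (hexc : ∀ R : ℝ, 0 < R → ∃ S : ℝ, 0 < S ∧ nbhd R A ∩ nbhd R B ⊆ nbhd S (A ∩ B))
    (f : X → Y)
    (hfA : IsCoarseMap (fun a : A => f a))
    (hfB : IsCoarseMap (fun b : B => f b)) :
    IsCoarseMap f := by
  have hcover (x : X) : x ∈ A ∨ x ∈ B := hAB.ge (Set.mem_univ x)
  constructor
  · intro R hR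
    obtain ⟨SA, hSA, hA⟩ := hfA.1 R hR
    obtain ⟨SB, hSB, hB⟩ := hfB.1 R hR
    obtain ⟨S, hS⟩ := exists_dist_le_of_coarsely_excisive hR (hexc R hR) hfA.1 hfB.1
    refine ⟨max S (max SA SB), by positivity, fun x y hxy => ?_⟩
    rcases hcover x with hx | hx <;> rcases hcover y with hy | hy
    · exact le_max_of_le_right (le_max_of_le_left (hA ⟨x, hx⟩ ⟨y, hy⟩ hxy))
    · exact le_max_of_le_left (hS x hx y hy hxy)
    · rw [dist_comm] at hxy ⊢
      exact le_max_of_le_left (hS y hy x hx hxy)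
    · exact le_max_of_le_right (le_max_of_le_right (hB ⟨x, hx⟩ ⟨y, hy⟩ hxy))
  · intro T hT
    refine ((Bornology.isBounded_image_subtype_val.2 (hfA.2 T hT)).union
      (Bornology.isBounded_image_subtype_val.2 (hfB.2 T hT))).subset fun x hx => ?_
    exact (hcover x).imp (fun h => ⟨⟨x, h⟩, hx, rfl⟩) (fun h => ⟨⟨x, h⟩, hx, rfl⟩)
end

section
/- Let v₀, …, vₙ ∈ ℝ^N be affinely independent and let σ be their convex hull. Then: (i) for any points w₀, …, wₙ ∈ ℝ^M there is a unique affine map f : affineSpan{v₀, …, vₙ} → ℝ^M with f(vᵢ) = wᵢ for all i; (ii) there is a constant C > 0, depending only on v₀, …, vₙ, such that for every choice of w₀, …, wₙ ∈ ℝ^M the restriction of this affine map f to σ is Lipschitz with constant C · max_{i,j} ‖wᵢ − wⱼ‖. -/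
/-- Values prescribed on an affinely independent family extend to an affine map. -/
theorem AffineIndependent.exists_affineMap_eq {k V P W Q ι : Type*} [DivisionRing k]
    [AddCommGroup V] [Module k V] [AddTorsor V P] [AddCommGroup W] [Module k W] [AddTorsor W Q]
    [Nonempty Q] {p : ι → P} (hp : AffineIndependent k p) (q : ι → Q) :
    ∃ f : P →ᵃ[k] Q, ∀ i, f (p i) = q i := by
  rcases isEmpty_or_nonempty ι with _ | ⟨⟨i₀⟩⟩
  · exact ⟨AffineMap.const k P (Classical.arbitrary Q), isEmptyElim⟩
  have hli := (affineIndependent_iff_linearIndependent_vsub k p i₀).1 hp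
  obtain ⟨L, hL⟩ := LinearMap.exists_extend
    ((Module.Basis.span hli).constr ℕ fun i => q i -ᵥ q i₀)
  have hL' (i : {x // x ≠ i₀}) : L (p i -ᵥ p i₀) = q i -ᵥ q i₀ := by
    have h := LinearMap.congr_fun hL (Module.Basis.span hli i)
    rw [Module.Basis.constr_basis, LinearMap.comp_apply, Submodule.subtype_apply,
      Module.Basis.span_apply] at h
    exact h
  refine ⟨⟨fun x => L (x -ᵥ p i₀) +ᵥ q i₀, L, fun x v => ?_⟩, fun i => ?_⟩
  · rw [vadd_vsub_assoc, map_add, add_vadd]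
  · change L (p i -ᵥ p i₀) +ᵥ q i₀ = q i
    by_cases hi : i = i₀
    · subst hi
      simp
    · rw [hL' ⟨i, hi⟩, vsub_vadd]

/-- A linear combination of vectors of norm at most `D` is controlled by the sup norm of its
coefficients. -/
theorem norm_linearCombination_le {ι F : Type*} [Fintype ι] [NormedAddCommGroup F]
    [NormedSpace ℝ F] {u : ι → F} {D : ℝ} (hu : ∀ i, ‖u i‖ ≤ D) (a : ι → ℝ) :
    ‖Fintype.linearCombination ℝ u a‖ ≤ Fintype.card ι * (‖a‖ * D) := by
  rw [Fintype.linearCombination_apply, ← nsmul_eq_mul, ← Finset.card_univ]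
  refine (norm_sum_le _ _).trans (Finset.sum_le_card_nsmul _ _ _ fun i _ => ?_)
  rw [norm_smul]
  exact mul_le_mul (norm_le_pi_norm a i) (hu i) (norm_nonneg _) (norm_nonneg _)

/-- On the affine span of a finite affinely independent family, affine maps are Lipschitz, with
constant proportional to a bound on the distances between the images of the points. -/
theorem AffineIndependent.exists_norm_sub_le {ι E : Type*} [Fintype ι]
    [NormedAddCommGroup E] [NormedSpace ℝ E] [FiniteDimensional ℝ E]
    {v : ι → E} (hv : AffineIndependent ℝ v) (i₀ : ι) :
    ∃ C : ℝ, 0 < C ∧ ∀ {F : Type*} [NormedAddCommGroup F] [NormedSpace ℝ F]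
      (f : E →ᵃ[ℝ] F) {D : ℝ}, (∀ i, ‖f (v i) - f (v i₀)‖ ≤ D) →
      ∀ x ∈ affineSpan ℝ (Set.range v), ∀ y ∈ affineSpan ℝ (Set.range v),
        ‖f x - f y‖ ≤ C * D * ‖x - y‖ := by
  classical
  obtain ⟨c, hc⟩ : ∃ c : E →ᵃ[ℝ] (ι → ℝ), ∀ i, c (v i) = Pi.single i 1 :=
    hv.exists_affineMap_eq fun i => Pi.single i 1
  set A := LinearMap.toContinuousLinearMap c.linear
  refine ⟨Fintype.card ι * ‖A‖ + 1, by positivity, fun {F} _ _ f {D} hD x hx y hy => ?_⟩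
  set u : ι → F := fun i => f (v i) - f (v i₀)
  have hD0 : 0 ≤ D := (norm_nonneg _).trans (hD i₀)
  let g : E →ᵃ[ℝ] F :=
    (Fintype.linearCombination ℝ u).toAffineMap.comp c + AffineMap.const ℝ E (f (v i₀))
  have hfg : Set.EqOn f g (affineSpan ℝ (Set.range v)) := by
    refine AffineMap.eqOn_affineSpan ?_
    rintro _ ⟨i, rfl⟩
    simp [g, hc, u, Fintype.linearCombination_apply_single]
  have hsub : f x - f y = Fintype.linearCombination ℝ u (A (x - y)) := by
    rw [hfg hx, hfg hy]
    have h := c.linearMap_vsub x y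
    simp only [vsub_eq_sub] at h
    simp [g, A, h]
  calc ‖f x - f y‖ ≤ Fintype.card ι * (‖A (x - y)‖ * D) := by
        rw [hsub]
        exact norm_linearCombination_le hD _
    _ ≤ Fintype.card ι * (‖A‖ * ‖x - y‖ * D) := by
        gcongr
        exact A.le_opNorm _
    _ ≤ (Fintype.card ι * ‖A‖ + 1) * D * ‖x - y‖ := by
        nlinarith [mul_nonneg hD0 (norm_nonneg (x - y))]

/-- Simplicial maps between geometric simplices are Lipschitz: given affinely
independent points `v₀, …, vₙ` in `ℝ^N` spanning the geometric simplex
`σ = convexHull {v₀, …, vₙ}`, (i) for any points `w₀, …, wₙ` in `ℝ^M` there is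
an affine map sending `vᵢ ↦ wᵢ`, and it is unique on the affine span of the `vᵢ`;
(ii) there is a constant `C > 0` depending only on the `vᵢ` such that any such
affine map is Lipschitz on `σ` with constant `C * max_{i,j} ‖wᵢ − wⱼ‖`. -/
theorem affine_simplex_map_exists_unique_and_lipschitz {N M n : ℕ}
    (v : Fin (n + 1) → EuclideanSpace ℝ (Fin N)) (hv : AffineIndependent ℝ v) :
    (∀ w : Fin (n + 1) → EuclideanSpace ℝ (Fin M),
      (∃ f : EuclideanSpace ℝ (Fin N) →ᵃ[ℝ] EuclideanSpace ℝ (Fin M),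
        ∀ i, f (v i) = w i) ∧
      (∀ f g : EuclideanSpace ℝ (Fin N) →ᵃ[ℝ] EuclideanSpace ℝ (Fin M),
        (∀ i, f (v i) = w i) → (∀ i, g (v i) = w i) →
        ∀ x ∈ affineSpan ℝ (Set.range v), f x = g x)) ∧
    (∃ C : ℝ, 0 < C ∧ ∀ w : Fin (n + 1) → EuclideanSpace ℝ (Fin M),
      ∀ f : EuclideanSpace ℝ (Fin N) →ᵃ[ℝ] EuclideanSpace ℝ (Fin M),
      (∀ i, f (v i) = w i) →
      ∀ x ∈ convexHull ℝ (Set.range v), ∀ y ∈ convexHull ℝ (Set.range v),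
        ‖f x - f y‖ ≤ (C * ⨆ i, ⨆ j, ‖w i - w j‖) * ‖x - y‖) := by
  refine ⟨fun w => ⟨hv.exists_affineMap_eq w, fun f g hf hg => ?_⟩, ?_⟩
  · refine AffineMap.eqOn_affineSpan ?_
    rintro _ ⟨i, rfl⟩
    rw [hf, hg]
  · obtain ⟨C, hC, h⟩ := hv.exists_norm_sub_le 0
    refine ⟨C, hC, fun w f hf x hx y hy => h f (fun i => ?_) x
      (convexHull_subset_affineSpan _ hx) y (convexHull_subset_affineSpan _ hy)⟩
    rw [hf, hf]
    exact (le_ciSup (f := fun j => ‖w i - w j‖) (Set.finite_range _).bddAbove 0).trans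
      (le_ciSup (f := fun i => ⨆ j, ‖w i - w j‖) (Set.finite_range _).bddAbove i)
end

section
/- Let X and Y be metric spaces. Then the relation of being coarsely homotopic is an equivalence relation on the set of coarse maps from X to Y: it is reflexive, symmetric, and transitive. -/
open scoped NNReal

/-- The `p`-cylinder `I_pX = {(x,t) ∈ X × ℝ₊ : t ≤ p x + 1}`; as a subset of the
product `X × ℝ₊` it carries the sup metric `max (dist x y) |s - t|`. -/
def cylSet {X : Type*} (p : X → ℝ≥0) : Set (X × ℝ≥0) :=
  {z | z.2 ≤ p z.1 + 1}

/-- Two coarse maps `f₀ f₁ : X → Y` are coarsely homotopic if there is a coarse map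
`p : X → ℝ₊` and a coarse map `H : I_pX → Y` with `H ∘ i₀ = f₀` and `H ∘ i₁ = f₁`,
where `i₀ x = (x, 0)` and `i₁ x = (x, p x + 1)`. -/
def CoarseHomotopic {X Y : Type*} [PseudoMetricSpace X] [PseudoMetricSpace Y]
    (f₀ f₁ : X → Y) : Prop :=
  ∃ p : X → ℝ≥0, IsCoarseMap p ∧ ∃ H : cylSet p → Y, IsCoarseMap H ∧
    (∀ x : X, H ⟨(x, 0), by simp [cylSet]⟩ = f₀ x) ∧
    (∀ x : X, H ⟨(x, p x + 1), by simp [cylSet]⟩ = f₁ x)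

section Controlled

variable {X Y Z : Type*} [PseudoMetricSpace X] [PseudoMetricSpace Y] [PseudoMetricSpace Z]

theorem Controlled.comp {g : Y → Z} {f : X → Y} (hg : Controlled g) (hf : Controlled f) :
    Controlled (fun x => g (f x)) := by
  intro R hR
  obtain ⟨S, hS, h⟩ := hf R hR
  obtain ⟨T, hT, h'⟩ := hg S hS
  exact ⟨T, hT, fun x y hxy => h' _ _ (h x y hxy)⟩

theorem Controlled.of_dist_le {f : X → Y} (hf : ∀ x y, dist (f x) (f y) ≤ dist x y) :
    Controlled f :=
  fun R hR => ⟨R, hR, fun x y hxy => (hf x y).trans hxy⟩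

/-- A map whose distances are dominated by the sum of those of two controlled maps is
controlled. -/
theorem Controlled.of_dist_le_add {W : Type*} [PseudoMetricSpace W] {f : X → Y} {g : X → Z}
    {k : X → W} (hf : Controlled f) (hg : Controlled g)
    (hk : ∀ x y, dist (k x) (k y) ≤ dist (f x) (f y) + dist (g x) (g y)) : Controlled k := by
  intro R hR
  obtain ⟨S, hS, h⟩ := hf R hR
  obtain ⟨T, hT, h'⟩ := hg R hR
  exact ⟨S + T, by positivity, fun x y hxy =>
    (hk x y).trans (add_le_add (h x y hxy) (h' x y hxy))⟩

theorem Controlled.isBounded_image {f : X → Y} (hf : Controlled f) {s : Set X}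
    (hs : Bornology.IsBounded s) : Bornology.IsBounded (f '' s) := by
  obtain ⟨C, hC⟩ := Metric.isBounded_iff.1 hs
  obtain ⟨S, -, h⟩ := hf (max C 1) (by positivity)
  refine Metric.isBounded_iff.2 ⟨S, ?_⟩
  rintro _ ⟨x, hx, rfl⟩ _ ⟨y, hy, rfl⟩
  exact h x y ((hC hx hy).trans (le_max_left _ _))

theorem Controlled.add {f g : X → ℝ≥0} (hf : Controlled f) (hg : Controlled g) :
    Controlled (fun x => f x + g x) :=
  hf.of_dist_le_add hg fun x y => by
    simpa only [NNReal.dist_eq, NNReal.coe_add, Real.dist_eq] using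
      dist_add_add_le (f x : ℝ) (g x) (f y) (g y)

theorem Controlled.add_const {f : X → ℝ≥0} (hf : Controlled f) (c : ℝ≥0) :
    Controlled (fun x => f x + c) :=
  hf.add (.of_dist_le fun x y => by simp)

theorem Controlled.min {f g : X → ℝ≥0} (hf : Controlled f) (hg : Controlled g) :
    Controlled (fun x => min (f x) (g x)) := by
  refine hf.of_dist_le_add hg fun x y => ?_
  simp only [NNReal.dist_eq, NNReal.coe_min]
  exact (abs_min_sub_min_le_max _ _ _ _).trans
    (max_le_add_of_nonneg (abs_nonneg _) (abs_nonneg _))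

theorem Controlled.tsub {f g : X → ℝ≥0} (hf : Controlled f) (hg : Controlled g) :
    Controlled (fun x => f x - g x) := by
  refine hf.of_dist_le_add hg fun x y => ?_
  simp only [NNReal.dist_eq, NNReal.coe_sub_def]
  refine (abs_max_sub_max_le_abs _ _ _).trans ?_
  rw [sub_sub_sub_comm]
  exact abs_sub _ _

end Controlled

section Cylinder

variable {X Y Z : Type*} [PseudoMetricSpace X] [PseudoMetricSpace Y] [PseudoMetricSpace Z]
  {p : X → ℝ≥0}

theorem controlled_cylSet_fst : Controlled (fun z : cylSet p => z.1.1) :=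
  .of_dist_le fun _ _ => le_max_left _ _

theorem controlled_cylSet_snd : Controlled (fun z : cylSet p => z.1.2) :=
  .of_dist_le fun _ _ => le_max_right _ _

theorem Controlled.cylSet_mk {f : Z → X} {t : Z → ℝ≥0} (hf : Controlled f) (ht : Controlled t)
    (h : ∀ z, (f z, t z) ∈ cylSet p) : Controlled (fun z => (⟨(f z, t z), h z⟩ : cylSet p)) :=
  hf.of_dist_le_add ht fun _ _ => max_le_add_of_nonneg dist_nonneg dist_nonneg

theorem isCoarseMap_nndist (x₀ : X) : IsCoarseMap (fun x => nndist x x₀) := by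
  refine ⟨.of_dist_le fun x y => ?_, fun B hB => ?_⟩
  · simpa [NNReal.dist_eq] using abs_dist_sub_le x y x₀
  · obtain ⟨M, hM⟩ := hB.bddAbove
    refine (Metric.isBounded_closedBall (x := x₀) (r := M)).subset fun x hx => ?_
    exact_mod_cast hM hx

theorem exists_isCoarseMap_nnreal (X : Type*) [PseudoMetricSpace X] :
    ∃ p : X → ℝ≥0, IsCoarseMap p := by
  rcases isEmpty_or_nonempty X with _ | ⟨⟨x₀⟩⟩
  · exact ⟨fun _ => 0, .of_dist_le fun x => isEmptyElim x, fun B _ => by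
      simp [Set.eq_empty_of_isEmpty]⟩
  · exact ⟨_, isCoarseMap_nndist x₀⟩

/-- The projection of a cylinder to its base is coarse. -/
theorem isCoarseMap_cylSet_fst (hp : Controlled p) :
    IsCoarseMap (fun z : cylSet p => z.1.1) := by
  refine ⟨controlled_cylSet_fst, fun B hB => ?_⟩
  obtain ⟨M, hM⟩ := (hp.isBounded_image hB).bddAbove
  rw [← Bornology.isBounded_image_subtype_val]
  refine (hB.prod (Metric.isBounded_Icc (0 : ℝ≥0) (M + 1))).subset ?_
  rintro _ ⟨z, hz, rfl⟩
  exact ⟨hz, zero_le, z.2.trans (by gcongr; exact hM ⟨_, hz, rfl⟩)⟩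

theorem IsCoarseMap.comp {g : Y → Z} {f : X → Y} (hg : IsCoarseMap g) (hf : IsCoarseMap f) :
    IsCoarseMap (fun x => g (f x)) :=
  ⟨hg.1.comp hf.1, fun B hB => hf.2 _ (hg.2 B hB)⟩

/-- The end-to-end reflection of a cylinder. -/
def cylFlip (p : X → ℝ≥0) (z : cylSet p) : cylSet p :=
  ⟨(z.1.1, p z.1.1 + 1 - z.1.2),
    (tsub_le_self : p z.1.1 + 1 - z.1.2 ≤ p z.1.1 + 1)⟩

theorem cylFlip_cylFlip {X : Type*} {p : X → ℝ≥0} (z : cylSet p) : cylFlip p (cylFlip p z) = z :=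
  by
  have h : z.1.2 ≤ p z.1.1 + 1 := z.2
  exact Subtype.ext (Prod.ext rfl (tsub_tsub_cancel_of_le h))

theorem isCoarseMap_cylFlip (hp : Controlled p) : IsCoarseMap (cylFlip p) := by
  have h : Controlled (cylFlip p) := controlled_cylSet_fst.cylSet_mk
    (((hp.comp controlled_cylSet_fst).add_const 1).tsub controlled_cylSet_snd) _
  refine ⟨h, fun B hB => (h.isBounded_image hB).subset fun z hz => ?_⟩
  exact ⟨_, hz, cylFlip_cylFlip z⟩

theorem CoarseHomotopic.refl {f : X → Y} (hf : IsCoarseMap f) : CoarseHomotopic f f := by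
  obtain ⟨p, hp⟩ := exists_isCoarseMap_nnreal X
  exact ⟨p, hp, fun z => f z.1.1, hf.comp (isCoarseMap_cylSet_fst hp.1),
    fun _ => rfl, fun _ => rfl⟩

theorem CoarseHomotopic.symm {f g : X → Y} (h : CoarseHomotopic f g) : CoarseHomotopic g f := by
  obtain ⟨p, hp, H, hH, h₀, h₁⟩ := h
  refine ⟨p, hp, fun z => H (cylFlip p z), hH.comp (isCoarseMap_cylFlip hp.1),
    fun x => ?_, fun x => ?_⟩
  · simpa [cylFlip] using h₁ x
  · simpa [cylFlip] using h₀ x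

theorem CoarseHomotopic.trans {f g h : X → Y} (hg : IsCoarseMap g)
    (hfg : CoarseHomotopic f g) (hgh : CoarseHomotopic g h) : CoarseHomotopic f h := by
  obtain ⟨p, hp, H, hH, hH₀, hH₁⟩ := hfg
  obtain ⟨q, hq, K, hK, hK₀, hK₁⟩ := hgh
  set r : X → ℝ≥0 := fun x => p x + 1 + q x with hr
  have hp' : Controlled (fun x => p x + 1) := hp.1.add_const 1
  have hrc : IsCoarseMap r := by
    refine ⟨hp'.add hq.1, fun B hB => ?_⟩
    obtain ⟨M, hM⟩ := hB.bddAbove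
    refine (hp.2 _ (Metric.isBounded_Icc (0 : ℝ≥0) M)).subset fun x hx => ⟨zero_le, ?_⟩
    exact (le_self_add.trans le_self_add).trans (hM hx)
  let a : cylSet r → cylSet p := fun z => ⟨(z.1.1, min z.1.2 (p z.1.1 + 1)),
    min_le_right z.1.2 (p z.1.1 + 1)⟩
  let b : cylSet r → cylSet q := fun z => ⟨(z.1.1, z.1.2 - (p z.1.1 + 1)),
    show z.1.2 - (p z.1.1 + 1) ≤ q z.1.1 + 1 from
      tsub_le_iff_left.2 (z.2.trans_eq (add_assoc _ _ _))⟩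
  let i : cylSet p → cylSet r := fun z => ⟨z.1,
    show z.1.2 ≤ p z.1.1 + 1 + q z.1.1 + 1 from z.2.trans (le_self_add.trans le_self_add)⟩
  let j : cylSet q → cylSet r := fun z => ⟨(z.1.1, p z.1.1 + 1 + z.1.2),
    show p z.1.1 + 1 + z.1.2 ≤ p z.1.1 + 1 + q z.1.1 + 1 from
      (add_le_add_right z.2 _).trans_eq (add_assoc _ _ _).symm⟩
  have ha : Controlled a := controlled_cylSet_fst.cylSet_mk
    (controlled_cylSet_snd.min (hp'.comp controlled_cylSet_fst)) _
  have hb : Controlled b := controlled_cylSet_fst.cylSet_mk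
    (controlled_cylSet_snd.tsub (hp'.comp controlled_cylSet_fst)) _
  have hi : Controlled i := .of_dist_le fun _ _ => le_rfl
  have hj : Controlled j := controlled_cylSet_fst.cylSet_mk
    ((hp'.comp controlled_cylSet_fst).add controlled_cylSet_snd) fun z => (j z).2
  have hHa : ∀ z : cylSet r, p z.1.1 + 1 ≤ z.1.2 → H (a z) = g z.1.1 := fun z hz => by
    simpa [a, hz] using hH₁ z.1.1
  have hKb : ∀ z : cylSet r, z.1.2 ≤ p z.1.1 + 1 → K (b z) = g z.1.1 := fun z hz => by
    simpa [b, tsub_eq_zero_of_le hz] using hK₀ z.1.1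
  have hia : ∀ z : cylSet r, z.1.2 ≤ p z.1.1 + 1 → i (a z) = z := fun z hz =>
    Subtype.ext (Prod.ext rfl (min_eq_left hz))
  have hjb : ∀ z : cylSet r, p z.1.1 + 1 ≤ z.1.2 → j (b z) = z := fun z hz =>
    Subtype.ext (Prod.ext rfl (add_tsub_cancel_of_le hz))
  refine ⟨r, hrc, fun z => if z.1.2 ≤ p z.1.1 + 1 then H (a z) else K (b z),
    ⟨fun R hR => ?_, fun B hB => ?_⟩, fun x => ?_, fun x => ?_⟩
  · obtain ⟨S₁, hS₁, h₁⟩ := (hH.1.comp ha) R hR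
    obtain ⟨S₂, hS₂, h₂⟩ := (hK.1.comp hb) R hR
    obtain ⟨S₃, hS₃, h₃⟩ := (hg.1.comp controlled_cylSet_fst) R hR
    have cross : ∀ z w : cylSet r, dist z w ≤ R → z.1.2 ≤ p z.1.1 + 1 → p w.1.1 + 1 ≤ w.1.2 →
        dist (H (a z)) (K (b w)) ≤ S₁ + S₃ + S₂ := fun z w hzw hz hw => by
      have e₁ := h₁ z w hzw
      have e₂ := h₂ z w hzw
      have e₃ := h₃ w z (dist_comm z w ▸ hzw)
      dsimp only at e₁ e₂ e₃
      rw [hHa w hw] at e₁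
      rw [hKb z hz] at e₂
      exact (dist_triangle4 _ _ _ _).trans (by gcongr)
    refine ⟨S₁ + S₃ + S₂, by positivity, fun z w hzw => ?_⟩
    dsimp only
    split_ifs with hz hw hw
    · exact (h₁ z w hzw).trans (by linarith)
    · exact cross z w hzw hz (le_of_not_ge hw)
    · rw [dist_comm]
      exact cross w z (dist_comm z w ▸ hzw) hw (le_of_not_ge hz)
    · exact (h₂ z w hzw).trans (by linarith)
  · refine ((hi.isBounded_image (hH.2 B hB)).union
      (hj.isBounded_image (hK.2 B hB))).subset fun z hz => ?_
    rw [Set.mem_preimage] at hz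
    split_ifs at hz with h
    · exact .inl ⟨a z, hz, hia z h⟩
    · exact .inr ⟨b z, hz, hjb z (le_of_not_ge h)⟩
  · simpa [a] using hH₀ x
  · have : ¬ r x + 1 ≤ p x + 1 := by
      simp only [hr, not_le, add_assoc]
      gcongr
      exact lt_add_of_pos_right _ (by positivity)
    have e : r x + 1 - (p x + 1) = q x + 1 := by
      rw [hr, add_assoc, add_tsub_cancel_left]
    simpa only [b, if_neg this, e] using hK₁ x

end Cylinder

theorem coarseHomotopic_equivalence {X Y : Type*} [PseudoMetricSpace X] [PseudoMetricSpace Y] :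
    (∀ f : X → Y, IsCoarseMap f → CoarseHomotopic f f) ∧
    (∀ f g : X → Y, IsCoarseMap f → IsCoarseMap g →
      CoarseHomotopic f g → CoarseHomotopic g f) ∧
    (∀ f g h : X → Y, IsCoarseMap f → IsCoarseMap g → IsCoarseMap h →
      CoarseHomotopic f g → CoarseHomotopic g h → CoarseHomotopic f h) :=
  ⟨fun _ hf => .refl hf, fun _ _ _ _ h => h.symm, fun _ _ _ _ hg _ hfg hgh => hfg.trans hg hgh⟩
end

section
/- Let X and Y be metric spaces and let p, q : X → ℝ₊ be coarse maps. Write I_{p+q}X = A ∪ B where A = {(x,t) ∈ I_{p+q}X : t ≤ p(x)} and B = {(x,t) ∈ I_{p+q}X : t ≥ p(x)}, and here I_{p+q}X = {(x,t) ∈ X × ℝ₊ : t ≤ p(x) + q(x) + 1}. Suppose f : I_{p+q}X → Y is a map such that the restrictions f|_A and f|_B are coarse maps. Then f is a coarse map. -/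
open scoped NNReal

/-- A point below the graph of `p` and a nearby point above it are both close to the graph. -/
theorem Controlled.exists_dist_graph_le {X : Type*} [PseudoMetricSpace X] {p : X → ℝ≥0}
    (hp : Controlled p) {R : ℝ} (hR : 0 < R) :
    ∃ T : ℝ, 0 < T ∧ ∀ z w : X × ℝ≥0, dist z w ≤ R → z.2 ≤ p z.1 → p w.1 ≤ w.2 →
      dist z (z.1, p z.1) ≤ T ∧ dist (z.1, p z.1) w ≤ T := by
  obtain ⟨S, hS, h⟩ := hp R hR
  refine ⟨S + 2 * R, by positivity, ?_⟩
  rintro ⟨x, s⟩ ⟨y, t⟩ hd hs ht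
  simp only [Prod.dist_eq, max_le_iff, dist_self] at hd hs ht ⊢
  obtain ⟨hxy, hst⟩ := hd
  have hpxy := h x y hxy
  rw [NNReal.dist_eq, abs_le] at hst hpxy
  have hs' : (s : ℝ) ≤ p x := hs
  have ht' : (p y : ℝ) ≤ t := ht
  simp only [NNReal.dist_eq, abs_le]
  refine ⟨⟨?_, ?_, ?_⟩, ?_, ?_, ?_⟩ <;> linarith

/-- If `p, q : X → ℝ₊` are coarse, `I_{p+q}X = A ∪ B` with
`A = {(x,t) : t ≤ p x}` and `B = {(x,t) : p x ≤ t}`, and `f : I_{p+q}X → Y`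
restricts to coarse maps on `A` and on `B`, then `f` is coarse. -/
theorem coarse_of_coarse_on_cylinder_pieces {X Y : Type*}
    [PseudoMetricSpace X] [PseudoMetricSpace Y]
    (p q : X → ℝ≥0) (hp : IsCoarseMap p) (hq : IsCoarseMap q)
    (f : cylSet (fun x => p x + q x) → Y)
    (hfA : IsCoarseMap
      (fun z : {z : X × ℝ≥0 // z.2 ≤ p z.1 + q z.1 + 1 ∧ z.2 ≤ p z.1} =>
        f ⟨z.1, z.2.1⟩))
    (hfB : IsCoarseMap
      (fun z : {z : X × ℝ≥0 // z.2 ≤ p z.1 + q z.1 + 1 ∧ p z.1 ≤ z.2} =>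
        f ⟨z.1, z.2.1⟩)) :
    IsCoarseMap f := by
  constructor
  · intro R hR
    obtain ⟨T, hT, hgraph⟩ := hp.1.exists_dist_graph_le hR
    obtain ⟨SA, hSA, hA⟩ := hfA.1 (max R T) (lt_max_of_lt_left hR)
    obtain ⟨SB, hSB, hB⟩ := hfB.1 (max R T) (lt_max_of_lt_left hR)
    have mixed : ∀ z w : cylSet (fun x => p x + q x), dist z w ≤ R →
        z.1.2 ≤ p z.1.1 → p w.1.1 ≤ w.1.2 → dist (f z) (f w) ≤ SA + SB := by
      intro z w hd hz hw
      obtain ⟨hzm, hmw⟩ := hgraph z.1 w.1 hd hz hw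
      have hm : p z.1.1 ≤ p z.1.1 + q z.1.1 + 1 := by
        rw [add_assoc]
        exact le_self_add
      have h₁ := hA ⟨z.1, z.2, hz⟩ ⟨(z.1.1, p z.1.1), hm, le_rfl⟩
        (hzm.trans (le_max_right _ _))
      have h₂ := hB ⟨(z.1.1, p z.1.1), hm, le_rfl⟩ ⟨w.1, w.2, hw⟩
        (hmw.trans (le_max_right _ _))
      exact (dist_triangle _ _ _).trans (add_le_add h₁ h₂)
    refine ⟨SA + SB, by positivity, fun z w hd => ?_⟩
    rcases le_total z.1.2 (p z.1.1) with hz | hz <;>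
      rcases le_total w.1.2 (p w.1.1) with hw | hw
    · have := hA ⟨z.1, z.2, hz⟩ ⟨w.1, w.2, hw⟩ (hd.trans (le_max_left _ _))
      exact this.trans (by linarith)
    · exact mixed z w hd hz hw
    · rw [dist_comm]
      exact mixed w z (by rwa [dist_comm]) hw hz
    · have := hB ⟨z.1, z.2, hz⟩ ⟨w.1, w.2, hw⟩ (hd.trans (le_max_left _ _))
      exact this.trans (by linarith)
  · intro V hV
    have hA : Bornology.IsBounded ((fun z : {z : X × ℝ≥0 // z.2 ≤ p z.1 + q z.1 + 1 ∧
        z.2 ≤ p z.1} => (⟨z.1, z.2.1⟩ : cylSet (fun x => p x + q x))) '' _) :=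
      (LipschitzWith.of_dist_le' (K := 1) fun x y => by
        simp [Subtype.dist_eq]).isBounded_image (hfA.2 V hV)
    have hB : Bornology.IsBounded ((fun z : {z : X × ℝ≥0 // z.2 ≤ p z.1 + q z.1 + 1 ∧
        p z.1 ≤ z.2} => (⟨z.1, z.2.1⟩ : cylSet (fun x => p x + q x))) '' _) :=
      (LipschitzWith.of_dist_le' (K := 1) fun x y => by
        simp [Subtype.dist_eq]).isBounded_image (hfB.2 V hV)
    refine (hA.union hB).subset fun z hz => ?_
    rcases le_total z.1.2 (p z.1.1) with h | h
    · exact Or.inl ⟨⟨z.1, z.2, h⟩, hz, rfl⟩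
    · exact Or.inr ⟨⟨z.1, z.2, h⟩, hz, rfl⟩
end

section
/- Let Y be a nonempty compact subset of a real Hilbert space H and let R ≥ 0. Then the inclusion c_R(Y) ↪ c(Y) is a coarse equivalence: it is a coarse map, and there exists a coarse map g : c(Y) → c_R(Y) such that the composite g ∘ incl is close to the identity of c_R(Y) and incl ∘ g is close to the identity of c(Y). -/
/-- The metric cone with flat base over a subset `Y` of a (Hilbert) space `E`:
`c(Y) = {(h • y, h) : y ∈ Y, h ≥ 0} ⊆ E × ℝ`, with the metric restricted from
`E × ℝ`. -/
def coneSet {E : Type*} [NormedAddCommGroup E] [NormedSpace ℝ E] (Y : Set E) :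
    Set (E × ℝ) :=
  {z | ∃ y ∈ Y, ∃ h : ℝ, 0 ≤ h ∧ z = (h • y, h)}

/-- A map distorting distances by at most an additive constant is coarse. -/
theorem isCoarseMap_of_abs_dist_sub_dist_le {X Y : Type*} [PseudoMetricSpace X]
    [PseudoMetricSpace Y] {f : X → Y} {K : ℝ}
    (hf : ∀ x y, |dist (f x) (f y) - dist x y| ≤ K) : IsCoarseMap f := by
  refine ⟨fun r hr => ⟨r + |K|, by positivity, fun x y hxy => ?_⟩, fun B hB => ?_⟩
  · linarith [(abs_le.mp (hf x y)).2, le_abs_self K]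
  · obtain ⟨C, hC⟩ := Metric.isBounded_iff.mp hB
    refine Metric.isBounded_iff.mpr ⟨C + K, fun x hx y hy => ?_⟩
    linarith [(abs_le.mp (hf x y)).1, hC hx hy]

/-- Over a bounded base, each point of the cone is uniformly close to the truncated cone. -/
theorem exists_dist_le_of_mem_coneSet {E : Type*} [NormedAddCommGroup E] [NormedSpace ℝ E]
    {Y : Set E} (hY : Bornology.IsBounded Y) {R : ℝ} (hR : 0 ≤ R) :
    ∃ K : ℝ, ∀ z ∈ coneSet Y, ∃ w ∈ coneSet Y ∩ {z : E × ℝ | R ≤ z.2}, dist w z ≤ K := by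
  obtain ⟨C, hC⟩ := hY.exists_norm_le
  refine ⟨R * max C 1, ?_⟩
  rintro _ ⟨y, hy, h, hh, rfl⟩
  refine ⟨(max h R • y, max h R), ⟨⟨y, hy, _, hh.trans (le_max_left _ _), rfl⟩,
    le_max_right h R⟩, ?_⟩
  have hdiff : |max h R - h| ≤ R := by
    rw [abs_of_nonneg (sub_nonneg.mpr (le_max_left _ _)), sub_le_iff_le_add]
    exact max_le (by linarith) (by linarith)
  rw [Prod.dist_eq, dist_eq_norm, ← sub_smul, norm_smul, Real.norm_eq_abs, Real.dist_eq]
  refine max_le ?_ ?_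
  · exact mul_le_mul hdiff ((hC y hy).trans (le_max_left _ _)) (norm_nonneg _) hR
  · exact hdiff.trans (le_mul_of_one_le_right hR (le_max_right _ _))

/-- For a nonempty compact subset `Y` of a real Hilbert space and `R ≥ 0`, the
inclusion `c_R(Y) ↪ c(Y)` is a coarse equivalence: it is coarse, and there is a
coarse map `g : c(Y) → c_R(Y)` with `g ∘ incl` close to the identity of `c_R(Y)`
and `incl ∘ g` close to the identity of `c(Y)`. -/
theorem cone_truncation_coarse_equivalence
    {E : Type*} [NormedAddCommGroup E] [InnerProductSpace ℝ E] [CompleteSpace E]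
    (Y : Set E) (hne : Y.Nonempty) (hcomp : IsCompact Y) (R : ℝ) (hR : 0 ≤ R) :
    IsCoarseMap (Set.inclusion (Set.inter_subset_left :
      coneSet Y ∩ {z : E × ℝ | R ≤ z.2} ⊆ coneSet Y)) ∧
    ∃ g : ↥(coneSet Y) → ↥(coneSet Y ∩ {z : E × ℝ | R ≤ z.2}),
      IsCoarseMap g ∧
      (∃ K : ℝ, ∀ z : ↥(coneSet Y ∩ {z : E × ℝ | R ≤ z.2}),
        dist (g (Set.inclusion Set.inter_subset_left z)) z ≤ K) ∧
      (∃ K : ℝ, ∀ z : ↥(coneSet Y),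
        dist (Set.inclusion Set.inter_subset_left (g z)) z ≤ K) := by
  obtain ⟨K, hK⟩ := exists_dist_le_of_mem_coneSet hcomp.isBounded hR
  choose g hg hgK using hK
  refine ⟨isCoarseMap_of_abs_dist_sub_dist_le (K := 0) fun x y => ?_,
    fun z => ⟨g z z.2, hg z z.2⟩,
    isCoarseMap_of_abs_dist_sub_dist_le (K := K + K) fun x y => ?_,
    ⟨K, fun z => hgK z z.2.1⟩, ⟨K, fun z => hgK z z.2⟩⟩
  · simp [Subtype.dist_eq]
  · rw [← Real.dist_eq]
    exact (dist_dist_dist_le _ _ _ _).trans (add_le_add (hgK x x.2) (hgK y y.2))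
end

section
/- Let K be a finite geometric simplicial complex in ℝ^N with a subcomplex K₀, and let L be a finite geometric simplicial complex in ℝ^M with a subcomplex L₀; write X, X₀, Y, Y₀ for the respective underlying spaces (with the metrics restricted from the ambient Euclidean spaces). Let f : X → Y be a continuous map with f(X₀) ⊆ Y₀. Then there exist a Lipschitz map g : X → Y with g(X₀) ⊆ Y₀ and a continuous homotopy H : X × [0,1] → Y with H(·,0) = f, H(·,1) = g, and H(X₀ × [0,1]) ⊆ Y₀. -/
open Geometry unitInterval

/-- A nonnegative continuous function on a compact metric space is approximated uniformly from
below by nonnegative Lipschitz functions. -/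
theorem exists_lipschitz_minorant {X : Type*} [PseudoMetricSpace X] [CompactSpace X]
    (φ : X → ℝ) (hφ : Continuous φ) (hφ₀ : ∀ x, 0 ≤ φ x) {ε : ℝ} (hε : 0 < ε) :
    ∃ h : X → ℝ, (∃ C : ℝ, 0 ≤ C ∧ ∀ x y, |h x - h y| ≤ C * dist x y) ∧
      (∀ x, 0 ≤ h x) ∧ (∀ x, h x ≤ φ x) ∧ ∀ x, φ x - ε ≤ h x := by
  obtain ⟨δ, hδ, hunif⟩ := Metric.uniformContinuous_iff.1
    (CompactSpace.uniformContinuous_of_continuous hφ) ε hε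
  obtain ⟨B, hB⟩ := (isCompact_range hφ).bddAbove
  have hφB : ∀ x, φ x ≤ B := fun x => hB ⟨x, rfl⟩
  set C : ℝ := |B| / δ
  have hC : 0 ≤ C := by positivity
  have hCδ : C * δ = |B| := div_mul_cancel₀ _ hδ.ne'
  have hterm : ∀ x y, 0 ≤ φ y + C * dist x y := fun x y =>
    add_nonneg (hφ₀ y) (mul_nonneg hC dist_nonneg)
  have hbdd : ∀ x, BddBelow (Set.range fun y => φ y + C * dist x y) := fun x =>
    ⟨0, by rintro _ ⟨y, rfl⟩; exact hterm x y⟩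
  have hle : ∀ x y, (⨅ z, φ z + C * dist x z) ≤ (⨅ z, φ z + C * dist y z) + C * dist x y := by
    intro x y
    have : Nonempty X := ⟨x⟩
    rw [← sub_le_iff_le_add]
    refine le_ciInf fun z => ?_
    have h₁ := ciInf_le (hbdd x) z
    have h₂ := mul_le_mul_of_nonneg_left (dist_triangle x y z) hC
    linarith
  refine ⟨fun x => ⨅ y, φ y + C * dist x y, ⟨C, hC, fun x y => ?_⟩, fun x => ?_, fun x => ?_,
    fun x => ?_⟩
  · have h₁ := hle x y
    have h₂ := hle y x
    rw [dist_comm y x] at h₂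
    rw [abs_le]
    constructor <;> linarith
  · exact Real.iInf_nonneg (hterm x)
  · simpa using ciInf_le (hbdd x) x
  · have : Nonempty X := ⟨x⟩
    refine le_ciInf fun y => ?_
    rcases lt_or_ge (dist x y) δ with h | h
    · have h₁ := hunif h
      rw [Real.dist_eq] at h₁
      have h₂ := (abs_lt.1 h₁).2
      have h₃ : 0 ≤ C * dist x y := mul_nonneg hC dist_nonneg
      linarith
    · have h₁ := mul_le_mul_of_nonneg_left h hC
      have h₂ := hφB x
      have h₃ := le_abs_self B
      have h₄ := hφ₀ y
      linarith

/-- Every finite continuous partition of unity on a compact metric space can be replaced by a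
Lipschitz one with smaller supports. -/
theorem exists_lipschitz_partition {X ι : Type*} [PseudoMetricSpace X] [CompactSpace X]
    (V : Finset ι) (b : ι → X → ℝ) (hb : ∀ i, Continuous (b i)) (hb₀ : ∀ i x, 0 ≤ b i x)
    (hb₁ : ∀ x, ∑ i ∈ V, b i x = 1) :
    ∃ w : ι → X → ℝ, (∀ i ∈ V, ∃ C : ℝ, 0 ≤ C ∧ ∀ x y, |w i x - w i y| ≤ C * dist x y) ∧
      (∀ i x, 0 ≤ w i x) ∧ (∀ x, ∑ i ∈ V, w i x = 1) ∧ ∀ i x, b i x = 0 → w i x = 0 := by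
  have hε : (0 : ℝ) < 1 / (2 * (V.card + 1)) := by positivity
  choose h hlip h₀ hle hge using fun i => exists_lipschitz_minorant (b i) (hb i) (hb₀ i) hε
  choose C hC hlip using hlip
  set τ : X → ℝ := fun x => ∑ i ∈ V, h i x
  have hτ : ∀ x, 1 / 2 ≤ τ x := by
    intro x
    have h₁ : ∑ i ∈ V, (b i x - 1 / (2 * ((V.card : ℝ) + 1))) ≤ τ x :=
      Finset.sum_le_sum fun i _ => hge i x
    rw [Finset.sum_sub_distrib, hb₁, Finset.sum_const, nsmul_eq_mul] at h₁
    have h₂ : (V.card : ℝ) * (1 / (2 * ((V.card : ℝ) + 1))) ≤ 1 / 2 := by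
      rw [mul_one_div, div_le_div_iff₀ (by positivity) (by positivity)]
      linarith
    linarith
  have hτpos : ∀ x, 0 < τ x := fun x => lt_of_lt_of_le (by norm_num) (hτ x)
  have hτlip : ∀ x y, |τ x - τ y| ≤ (∑ i ∈ V, C i) * dist x y := by
    intro x y
    rw [← Finset.sum_sub_distrib, Finset.sum_mul]
    exact (Finset.abs_sum_le_sum_abs _ _).trans (Finset.sum_le_sum fun i _ => hlip i x y)
  refine ⟨fun i x => h i x / τ x, fun i hi => ⟨2 * (C i + ∑ j ∈ V, C j), ?_, fun x y => ?_⟩,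
    fun i x => div_nonneg (h₀ i x) (hτpos x).le, fun x => ?_, fun i x hx => ?_⟩
  · have := Finset.sum_nonneg fun j (_ : j ∈ V) => hC j
    have := hC i
    positivity
  · have hq₀ : 0 ≤ h i y / τ y := div_nonneg (h₀ i y) (hτpos y).le
    have hq₁ : h i y / τ y ≤ 1 := by
      rw [div_le_one (hτpos y)]
      exact Finset.single_le_sum (f := fun j => h j y) (fun j _ => h₀ j y) hi
    have key : h i x / τ x - h i y / τ y
        = ((h i x - h i y) - h i y / τ y * (τ x - τ y)) / τ x := by
      have := (hτpos x).ne'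
      have := (hτpos y).ne'
      field_simp
      ring
    have hnum : |(h i x - h i y) - h i y / τ y * (τ x - τ y)|
        ≤ (C i + ∑ j ∈ V, C j) * dist x y := by
      refine (abs_sub _ _).trans ?_
      rw [abs_mul, abs_of_nonneg hq₀, add_mul]
      refine add_le_add (hlip i x y) ?_
      exact (mul_le_of_le_one_left (abs_nonneg _) hq₁).trans (hτlip x y)
    rw [key, abs_div, abs_of_pos (hτpos x), div_le_iff₀ (hτpos x)]
    have h₁ := (abs_nonneg _).trans hnum
    nlinarith [hτ x]
  · rw [← Finset.sum_div]
    exact div_self (hτpos x).ne'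
  · have : h i x = 0 := le_antisymm (hx ▸ hle i x) (h₀ i x)
    simp [this]

/-- The weight functions of convex combinations of the points of `s`, extended by zero. -/
def convexWeights {E : Type*} (s : Finset E) : Set (E → ℝ) :=
  {w | (∀ v, 0 ≤ w v) ∧ (∀ v, v ∉ s → w v = 0) ∧ ∑ v ∈ s, w v = 1}

theorem convexWeights_mono {E : Type*} {s t : Finset E} (hst : s ⊆ t) :
    convexWeights s ⊆ convexWeights t := by
  rintro w ⟨h₀, h₁, h₂⟩
  refine ⟨h₀, fun v hv => h₁ v fun h => hv (hst h), ?_⟩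
  rw [← h₂, Finset.sum_subset hst fun v _ hv => h₁ v hv]

theorem isCompact_convexWeights {E : Type*} (s : Finset E) :
    IsCompact (convexWeights s) := by
  have hbox : IsCompact (Set.univ.pi fun _ : E => Set.Icc (0 : ℝ) 1) :=
    isCompact_univ_pi fun _ => isCompact_Icc
  refine hbox.of_isClosed_subset ?_ ?_
  · simp only [convexWeights, Set.ofPred_and, Set.ofPred_forall]
    refine (isClosed_iInter fun v => ?_).inter
      ((isClosed_iInter fun v => isClosed_iInter fun _ => ?_).inter ?_)
    · exact isClosed_le continuous_const (continuous_apply v)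
    · exact isClosed_eq (continuous_apply v) continuous_const
    · exact isClosed_eq (continuous_finsetSum _ fun v _ => continuous_apply v) continuous_const
  · rintro w ⟨h₀, h₁, h₂⟩ v -
    refine ⟨h₀ v, ?_⟩
    by_cases hv : v ∈ s
    · exact h₂ ▸ Finset.single_le_sum (fun u _ => h₀ u) hv
    · simp [h₁ v hv]

theorem sum_smul_mem_convexHull_of_mem_convexWeights {E : Type*} [AddCommGroup E] [Module ℝ E]
    {s : Finset E} {w : E → ℝ} (hw : w ∈ convexWeights s) :
    ∑ v ∈ s, w v • v ∈ convexHull ℝ (s : Set E) :=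
  Finset.mem_convexHull'.2 ⟨w, fun v _ => hw.1 v, hw.2.2, rfl⟩

theorem exists_convexWeights_of_mem_convexHull {E : Type*} [AddCommGroup E] [Module ℝ E]
    {s : Finset E} {y : E} (hy : y ∈ convexHull ℝ (s : Set E)) :
    ∃ w ∈ convexWeights s, ∑ v ∈ s, w v • v = y := by
  classical
  obtain ⟨w, h₀, h₁, h₂⟩ := Finset.mem_convexHull'.1 hy
  refine ⟨fun v => if v ∈ s then w v else 0, ⟨fun v => ?_, fun v hv => if_neg hv, ?_⟩, ?_⟩
  · dsimp only
    split_ifs with hv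
    exacts [h₀ v hv, le_rfl]
  · rw [← h₁]
    exact Finset.sum_congr rfl fun v hv => if_pos hv
  · rw [← h₂]
    exact Finset.sum_congr rfl fun v hv => by simp only [if_pos hv]

theorem sum_smul_eq_of_mem_convexWeights {E : Type*} [AddCommGroup E] [Module ℝ E]
    {s t : Finset E} (hst : s ⊆ t) {w : E → ℝ} (hw : w ∈ convexWeights s) :
    ∑ v ∈ s, w v • v = ∑ v ∈ t, w v • v :=
  Finset.sum_subset hst fun v _ hv => by rw [hw.2.1 v hv, zero_smul]

theorem AffineIndependent.convexWeights_eq {E : Type*} [AddCommGroup E] [Module ℝ E]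
    {s : Finset E} (hs : AffineIndependent ℝ ((↑) : s → E)) {w w' : E → ℝ}
    (hw : w ∈ convexWeights s) (hw' : w' ∈ convexWeights s)
    (h : ∑ v ∈ s, w v • v = ∑ v ∈ s, w' v • v) : w = w' := by
  funext v
  by_cases hv : v ∈ s
  · refine sub_eq_zero.1 (affineIndependent_iff.1 hs Finset.univ (fun u => w u - w' u) ?_ ?_
      ⟨v, hv⟩ (Finset.mem_univ _))
    · rw [Finset.sum_coe_sort s fun u => w u - w' u, Finset.sum_sub_distrib, hw.2.2, hw'.2.2,
        sub_self]
    · rw [Finset.sum_coe_sort s fun u => (w u - w' u) • u]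
      simp only [sub_smul]
      rw [Finset.sum_sub_distrib, h, sub_self]
  · rw [hw.2.1 v hv, hw'.2.1 v hv]

/-- In a simplicial complex, the barycentric coordinates of a point do not depend on the face used
to compute them. -/
theorem Geometry.SimplicialComplex.convexWeights_eq {E : Type*} [AddCommGroup E] [Module ℝ E]
    (L : SimplicialComplex ℝ E) {s t : Finset E} (hs : s ∈ L.faces) (ht : t ∈ L.faces)
    {w w' : E → ℝ} (hw : w ∈ convexWeights s) (hw' : w' ∈ convexWeights t)
    (h : ∑ v ∈ s, w v • v = ∑ v ∈ t, w' v • v) : w = w' := by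
  classical
  have hmem : ∑ v ∈ s, w v • v ∈ convexHull ℝ ((s ∩ t : Finset E) : Set E) := by
    rw [Finset.coe_inter]
    exact L.inter_subset_convexHull hs ht ⟨sum_smul_mem_convexHull_of_mem_convexWeights hw,
      h ▸ sum_smul_mem_convexHull_of_mem_convexWeights hw'⟩
  obtain ⟨u, hu, hsum⟩ := exists_convexWeights_of_mem_convexHull hmem
  have hus := sum_smul_eq_of_mem_convexWeights Finset.inter_subset_left hu
  have hut := sum_smul_eq_of_mem_convexWeights Finset.inter_subset_right hu
  have h₁ : w = u := (L.indep hs).convexWeights_eq hw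
    (convexWeights_mono Finset.inter_subset_left hu) (by rw [← hus, hsum])
  have h₂ : w' = u := (L.indep ht).convexWeights_eq hw'
    (convexWeights_mono Finset.inter_subset_right hu) (by rw [← hut, hsum, h])
  rw [h₁, h₂]

/-- A finite simplicial complex has continuous barycentric coordinates. -/
theorem Geometry.SimplicialComplex.exists_barycentric_coordinates {E : Type*}
    [NormedAddCommGroup E] [NormedSpace ℝ E] (L : SimplicialComplex ℝ E)
    (hL : L.faces.Finite) :
    ∃ V : Finset E, (∀ s ∈ L.faces, s ⊆ V) ∧ ∃ β : L.space → E → ℝ, Continuous β ∧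
      ∀ (y : L.space), ∀ s ∈ L.faces, (y : E) ∈ convexHull ℝ (s : Set E) →
        β y ∈ convexWeights s := by
  classical
  set V : Finset E := hL.toFinset.biUnion id
  have hV : ∀ s ∈ L.faces, s ⊆ V := fun s hs =>
    Finset.subset_biUnion_of_mem id (hL.mem_toFinset.2 hs)
  set S : Set (E → ℝ) := ⋃ s ∈ L.faces, convexWeights s
  have hS : IsCompact S := hL.isCompact_biUnion fun s _ => isCompact_convexWeights s
  have : CompactSpace S := isCompact_iff_compactSpace.1 hS
  have hmem : ∀ w : S, ∃ s ∈ L.faces, (w : E → ℝ) ∈ convexWeights s := fun w => by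
    simpa only [S, Set.mem_iUnion, exists_prop] using w.2
  let φ : S → L.space := fun w => ⟨∑ v ∈ V, (w : E → ℝ) v • v, by
    obtain ⟨s, hs, hw⟩ := hmem w
    rw [← sum_smul_eq_of_mem_convexWeights (hV s hs) hw]
    exact SimplicialComplex.convexHull_subset_space hs
      (sum_smul_mem_convexHull_of_mem_convexWeights hw)⟩
  have hφ : Continuous φ := Continuous.subtype_mk
    (continuous_finsetSum _ fun v _ =>
      ((continuous_apply v).comp continuous_subtype_val).smul continuous_const) _
  have hinj : Function.Injective φ := by
    intro w w' h
    obtain ⟨s, hs, hw⟩ := hmem w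
    obtain ⟨t, ht, hw'⟩ := hmem w'
    refine Subtype.ext (L.convexWeights_eq hs ht hw hw' ?_)
    rw [sum_smul_eq_of_mem_convexWeights (hV s hs) hw,
      sum_smul_eq_of_mem_convexWeights (hV t ht) hw']
    exact congrArg Subtype.val h
  have hlift : ∀ (y : L.space), ∀ s ∈ L.faces, (y : E) ∈ convexHull ℝ (s : Set E) →
      ∃ w : S, (w : E → ℝ) ∈ convexWeights s ∧ φ w = y := by
    intro y s hs hy
    obtain ⟨w, hw, hwy⟩ := exists_convexWeights_of_mem_convexHull hy
    refine ⟨⟨w, Set.mem_biUnion hs hw⟩, hw, Subtype.ext ?_⟩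
    rw [← hwy]
    exact (sum_smul_eq_of_mem_convexWeights (hV s hs) hw).symm
  have hsurj : Function.Surjective φ := by
    intro y
    obtain ⟨s, hs, hy⟩ := SimplicialComplex.mem_space_iff.1 y.2
    obtain ⟨w, -, hw⟩ := hlift y s hs hy
    exact ⟨w, hw⟩
  let e : S ≃ₜ L.space :=
    Continuous.homeoOfEquivCompactToT2 (f := Equiv.ofBijective φ ⟨hinj, hsurj⟩) hφ
  refine ⟨V, hV, fun y => (e.symm y : E → ℝ),
    continuous_subtype_val.comp e.symm.continuous, fun y s hs hy => ?_⟩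
  obtain ⟨w, hw, rfl⟩ := hlift y s hs hy
  have : e.symm (φ w) = w := e.symm_apply_apply w
  simpa only [this] using hw

theorem Geometry.SimplicialComplex.isCompact_space {E : Type*} [NormedAddCommGroup E]
    [NormedSpace ℝ E] (K : SimplicialComplex ℝ E) (hK : K.faces.Finite) :
    IsCompact K.space :=
  hK.isCompact_biUnion fun s _ => s.finite_toSet.isCompact_convexHull (𝕜 := ℝ)

/-- Any continuous map of pairs between (underlying spaces of) finite geometric
simplicial complexes is homotopic, as a map of pairs, to a Lipschitz map. -/
theorem continuous_map_homotopic_to_lipschitz {N M : ℕ}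
    (K K₀ : SimplicialComplex ℝ (EuclideanSpace ℝ (Fin N)))
    (L L₀ : SimplicialComplex ℝ (EuclideanSpace ℝ (Fin M)))
    (hKfin : K.faces.Finite) (hLfin : L.faces.Finite)
    (hK₀ : K₀.faces ⊆ K.faces) (hL₀ : L₀.faces ⊆ L.faces)
    (f : K.space → L.space) (hf : Continuous f)
    (hf₀ : ∀ x : K.space, (x : EuclideanSpace ℝ (Fin N)) ∈ K₀.space →
      (f x : EuclideanSpace ℝ (Fin M)) ∈ L₀.space) :
    ∃ g : K.space → L.space,
      (∃ C : ℝ, 0 < C ∧ ∀ x y : K.space, dist (g x) (g y) ≤ C * dist x y) ∧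
      (∀ x : K.space, (x : EuclideanSpace ℝ (Fin N)) ∈ K₀.space →
        (g x : EuclideanSpace ℝ (Fin M)) ∈ L₀.space) ∧
      ∃ H : K.space × I → L.space, Continuous H ∧
        (∀ x : K.space, H (x, 0) = f x) ∧
        (∀ x : K.space, H (x, 1) = g x) ∧
        (∀ (x : K.space) (t : I), (x : EuclideanSpace ℝ (Fin N)) ∈ K₀.space →
          (H (x, t) : EuclideanSpace ℝ (Fin M)) ∈ L₀.space) := by
  have : CompactSpace K.space := isCompact_iff_compactSpace.1 (K.isCompact_space hKfin)
  obtain ⟨V, hV, β, hβ, hβw⟩ := L.exists_barycentric_coordinates hLfin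
  have hface : ∀ x, ∃ s ∈ L.faces, (f x : EuclideanSpace ℝ (Fin M)) ∈
      convexHull ℝ (s : Set (EuclideanSpace ℝ (Fin M))) := fun x =>
    SimplicialComplex.mem_space_iff.1 (f x).2
  obtain ⟨w, hlip, hw₀, hw₁, hwβ⟩ := exists_lipschitz_partition V (fun v x => β (f x) v)
    (fun v => (continuous_apply v).comp (hβ.comp hf))
    (fun v x => by
      obtain ⟨s, hs, hx⟩ := hface x
      exact (hβw (f x) s hs hx).1 v)
    (fun x => by
      obtain ⟨s, hs, hx⟩ := hface x
      exact (convexWeights_mono (hV s hs) (hβw (f x) s hs hx)).2.2)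
  set G : K.space → EuclideanSpace ℝ (Fin M) := fun x => ∑ v ∈ V, w v x • v
  have hG : ∀ x, ∀ s ∈ L.faces, (f x : EuclideanSpace ℝ (Fin M)) ∈
      convexHull ℝ (s : Set (EuclideanSpace ℝ (Fin M))) →
      G x ∈ convexHull ℝ (s : Set (EuclideanSpace ℝ (Fin M))) := by
    intro x s hs hx
    have hzero : ∀ v, v ∉ s → w v x = 0 := fun v hv => hwβ v x ((hβw (f x) s hs hx).2.1 v hv)
    have hws : (fun v => w v x) ∈ convexWeights s := by
      refine ⟨fun v => hw₀ v x, hzero, ?_⟩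
      rw [← hw₁ x]
      exact Finset.sum_subset (hV s hs) fun v _ hv => hzero v hv
    have hmem := sum_smul_mem_convexHull_of_mem_convexWeights hws
    rwa [sum_smul_eq_of_mem_convexWeights (hV s hs) hws] at hmem
  have hline : ∀ (x : K.space) (t : I), ∀ s ∈ L.faces, (f x : EuclideanSpace ℝ (Fin M)) ∈
      convexHull ℝ (s : Set (EuclideanSpace ℝ (Fin M))) →
      (1 - (t : ℝ)) • (f x : EuclideanSpace ℝ (Fin M)) + (t : ℝ) • G x ∈
        convexHull ℝ (s : Set (EuclideanSpace ℝ (Fin M))) := fun x t s hs hx =>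
    convex_convexHull ℝ _ hx (hG x s hs hx) (sub_nonneg.2 t.2.2) t.2.1 (sub_add_cancel _ _)
  have hGL : ∀ x, G x ∈ L.space := fun x => by
    obtain ⟨s, hs, hx⟩ := hface x
    exact SimplicialComplex.convexHull_subset_space hs (hG x s hs hx)
  have hlineL : ∀ (x : K.space) (t : I),
      (1 - (t : ℝ)) • (f x : EuclideanSpace ℝ (Fin M)) + (t : ℝ) • G x ∈ L.space :=
    fun x t => by
      obtain ⟨s, hs, hx⟩ := hface x
      exact SimplicialComplex.convexHull_subset_space hs (hline x t s hs hx)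
  have hGlip : ∃ C : ℝ, 0 < C ∧ ∀ x y : K.space, dist (G x) (G y) ≤ C * dist x y := by
    choose! C hC hlip using hlip
    refine ⟨∑ v ∈ V, C v * ‖v‖ + 1, ?_, fun x y => ?_⟩
    · have := Finset.sum_nonneg fun v hv => mul_nonneg (hC v hv) (norm_nonneg v)
      linarith
    · rw [dist_eq_norm, ← Finset.sum_sub_distrib, add_mul, one_mul, Finset.sum_mul]
      refine (norm_sum_le _ _).trans (le_add_of_le_of_nonneg (Finset.sum_le_sum fun v hv => ?_)
        dist_nonneg)
      rw [← sub_smul, norm_smul, Real.norm_eq_abs, mul_right_comm]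
      exact mul_le_mul_of_nonneg_right (hlip v hv x y) (norm_nonneg v)
  have hGcont : Continuous G := by
    obtain ⟨C, hC, h⟩ := hGlip
    exact (LipschitzWith.of_dist_le_mul (K := ⟨C, hC.le⟩) h).continuous
  refine ⟨fun x => ⟨G x, hGL x⟩, hGlip, fun x hx => ?_, fun p => ⟨_, hlineL p.1 p.2⟩, ?_,
    fun x => ?_, fun x => ?_, fun x t hx => ?_⟩
  · obtain ⟨s, hs, hfs⟩ := SimplicialComplex.mem_space_iff.1 (hf₀ x hx)
    exact SimplicialComplex.convexHull_subset_space hs (hG x s (hL₀ hs) hfs)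
  · refine Continuous.subtype_mk ?_ _
    fun_prop
  · exact Subtype.ext (by simp)
  · exact Subtype.ext (by simp)
  · obtain ⟨s, hs, hfs⟩ := SimplicialComplex.mem_space_iff.1 (hf₀ x hx)
    exact SimplicialComplex.convexHull_subset_space hs (hline x t s (hL₀ hs) hfs)
end

section
/- Let K be a finite geometric simplicial complex in ℝ^N and L a finite geometric simplicial complex in ℝ^M, with underlying spaces X and Y (with the metrics restricted from the ambient Euclidean spaces). Let f₀, f₁ : X → Y be continuous maps that are homotopic, and let g₀, g₁ : X → Y be Lipschitz maps with g₀ homotopic to f₀ and g₁ homotopic to f₁. Then there exists a Lipschitz map H : X × [0,1] → Y with H(·,0) = g₀ and H(·,1) = g₁. -/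
open Geometry unitInterval

lemma sum_coe_sort_ite {E : Type*} [DecidableEq E] {V s : Finset E} (hs : s ⊆ V) {F : Type*}
    [AddCommMonoid F] (g : E → F) :
    ∑ v : V, (if (v : E) ∈ s then g v else 0) = ∑ y ∈ s, g y := by
  rw [Finset.sum_coe_sort V (fun y => if y ∈ s then g y else 0), ← Finset.sum_filter,
    Finset.filter_mem_eq_inter, Finset.inter_eq_right.2 hs]

section BarycentricCoordinates

variable {E : Type*} [NormedAddCommGroup E] [NormedSpace ℝ E]

/-- The linear map sending a weight function on a finite set of points to the corresponding
linear combination of these points. -/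
noncomputable def pointCombination (V : Finset E) : (V → ℝ) →ₗ[ℝ] E :=
  Fintype.linearCombination ℝ (Subtype.val : V → E)

lemma pointCombination_apply (V : Finset E) (w : V → ℝ) :
    pointCombination V w = ∑ v, w v • (v : E) := rfl

/-- The weight functions on `V` which are barycentric coordinates of a point of a face of `L`. -/
def barycentricWeights (L : SimplicialComplex ℝ E) (V : Finset E) : Set (V → ℝ) :=
  {w | (∀ v, 0 ≤ w v) ∧ ∑ v, w v = 1 ∧ ∃ s ∈ L.faces, ∀ v : V, w v ≠ 0 → (v : E) ∈ s}

lemma pointCombination_mem_convexHull {V : Finset E} {s : Set E} {w : V → ℝ}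
    (h₀ : ∀ v, 0 ≤ w v) (h₁ : ∑ v, w v = 1) (hs : ∀ v : V, w v ≠ 0 → (v : E) ∈ s) :
    pointCombination V w ∈ convexHull ℝ s := by
  rw [pointCombination_apply, ← finsum_eq_sum_of_fintype]
  refine (convex_convexHull ℝ s).finsum_mem h₀ ?_ fun v hv => subset_convexHull ℝ s (hs v hv)
  rwa [finsum_eq_sum_of_fintype]

lemma pointCombination_mem_space {L : SimplicialComplex ℝ E} {V : Finset E} {w : V → ℝ}
    (hw : w ∈ barycentricWeights L V) : pointCombination V w ∈ L.space := by
  obtain ⟨h₀, h₁, s, hs, hws⟩ := hw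
  exact SimplicialComplex.convexHull_subset_space hs (pointCombination_mem_convexHull h₀ h₁ hws)

lemma exists_weights_of_mem_convexHull {V s : Finset E} (hs : s ⊆ V) {x : E}
    (hx : x ∈ convexHull ℝ (s : Set E)) :
    ∃ w : V → ℝ, (∀ v, 0 ≤ w v) ∧ ∑ v, w v = 1 ∧ (∀ v : V, w v ≠ 0 → (v : E) ∈ s) ∧
      pointCombination V w = x := by
  classical
  obtain ⟨w, h₀, h₁, rfl⟩ := Finset.mem_convexHull'.1 hx
  refine ⟨fun v => if (v : E) ∈ s then w v else 0, fun v => ?_, ?_, fun v => by simp; tauto, ?_⟩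
  · dsimp only
    split_ifs with h
    exacts [h₀ _ h, le_rfl]
  · rw [sum_coe_sort_ite hs, h₁]
  · simp only [pointCombination_apply, ite_smul, zero_smul]
    exact sum_coe_sort_ite hs fun y => w y • y

lemma exists_barycentricWeights {L : SimplicialComplex ℝ E} {V : Finset E}
    (hV : ∀ s ∈ L.faces, s ⊆ V) {x : E} (hx : x ∈ L.space) :
    ∃ w ∈ barycentricWeights L V, pointCombination V w = x := by
  obtain ⟨s, hs, hxs⟩ := SimplicialComplex.mem_space_iff.1 hx
  obtain ⟨w, h₀, h₁, hw, hwx⟩ := exists_weights_of_mem_convexHull (hV s hs) hxs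
  exact ⟨w, ⟨h₀, h₁, s, hs, hw⟩, hwx⟩

lemma eq_zero_of_pointCombination_eq_zero {V s : Finset E}
    (hs : AffineIndependent ℝ ((↑) : s → E)) {w : V → ℝ} (hw : ∀ v : V, w v ≠ 0 → (v : E) ∈ s)
    (h₀ : ∑ v, w v = 0) (h : pointCombination V w = 0) : w = 0 := by
  classical
  set t : Finset V := {v | (v : E) ∈ s} with ht
  have hmem : ∀ v ∈ t, (v : E) ∈ s := by simp [ht]
  have hindep : AffineIndependent ℝ (fun v : t => ((v : V) : E)) :=
    hs.comp_embedding ⟨fun v : t => (⟨v, hmem v v.2⟩ : s), fun a b hab =>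
      Subtype.ext (Subtype.ext (Subtype.mk.inj hab))⟩
  have hout : ∀ v ∉ t, w v = 0 := fun v hv => by
    by_contra hne
    exact hv (by simpa [ht] using hw v hne)
  have key := hindep.eq_zero_of_sum_eq_zero (s := Finset.univ) (w := fun v : t => w v)
    (by
      rw [Finset.sum_coe_sort t w, ← h₀]
      exact Finset.sum_subset (Finset.subset_univ _) fun v _ hv => hout v hv)
    (by
      rw [Finset.sum_coe_sort t fun v => w v • (v : E), ← h, pointCombination_apply]
      exact Finset.sum_subset (Finset.subset_univ _) fun v _ hv => by simp [hout v hv])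
  funext v
  by_cases hv : v ∈ t
  · exact key ⟨v, hv⟩ (Finset.mem_univ _)
  · exact hout v hv

lemma eq_zero_of_pointCombination_eq_zero_of_faces {L : SimplicialComplex ℝ E} {V : Finset E}
    (hV : ∀ s ∈ L.faces, s ⊆ V) {s t : Finset E} (hs : s ∈ L.faces) (ht : t ∈ L.faces)
    {w : V → ℝ} (hws : ∀ v : V, 0 < w v → (v : E) ∈ s) (hwt : ∀ v : V, w v < 0 → (v : E) ∈ t)
    (h₀ : ∑ v, w v = 0) (h : pointCombination V w = 0) : w = 0 := by
  classical
  have hw : w = w⁺ - w⁻ := (posPart_sub_negPart w).symm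
  have hsum : ∑ v, w⁺ v = ∑ v, w⁻ v := by
    rw [← sub_eq_zero, ← Finset.sum_sub_distrib, ← h₀]
    exact Finset.sum_congr rfl fun v _ => (congrFun hw v).symm
  have hcomb : pointCombination V w⁺ = pointCombination V w⁻ := by
    rw [← sub_eq_zero, ← map_sub, ← hw, h]
  have hp : ∀ v, 0 ≤ w⁺ v := fun v => posPart_nonneg w v
  have hn : ∀ v, 0 ≤ w⁻ v := fun v => negPart_nonneg w v
  have hps : ∀ v : V, w⁺ v ≠ 0 → (v : E) ∈ s := fun v hv => hws v (by
    by_contra! hle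
    exact hv (by simpa using hle))
  have hnt : ∀ v : V, w⁻ v ≠ 0 → (v : E) ∈ t := fun v hv => hwt v (by
    by_contra! hle
    exact hv (by simpa using hle))
  set m := ∑ v, w⁺ v with hm
  rcases (Finset.sum_nonneg fun v _ => hp v : 0 ≤ m).eq_or_lt with hm0 | hmpos
  · have h1 := (Finset.sum_eq_zero_iff_of_nonneg fun v _ => hp v).1 (hm.symm.trans hm0.symm)
    have h2 := (Finset.sum_eq_zero_iff_of_nonneg fun v _ => hn v).1 (hsum.symm.trans hm0.symm)
    rw [hw]
    funext v
    simp only [Pi.sub_apply, h1 v (Finset.mem_univ v), h2 v (Finset.mem_univ v), sub_self,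
      Pi.zero_apply]
  · have hnorm : ∀ u : V → ℝ, ∑ v, u v = m → ∑ v, (m⁻¹ • u) v = 1 := fun u hu => by
      simp only [Pi.smul_apply, smul_eq_mul, ← Finset.mul_sum, hu]
      exact inv_mul_cancel₀ hmpos.ne'
    have hsupp : ∀ (u : V → ℝ) (v : V), (m⁻¹ • u) v ≠ 0 → u v ≠ 0 := fun u v hv huv =>
      hv (by simp [huv])
    have hnonneg : ∀ u : V → ℝ, (∀ v, 0 ≤ u v) → ∀ v, 0 ≤ (m⁻¹ • u) v := fun u hu v =>
      mul_nonneg (inv_nonneg.2 hmpos.le) (hu v)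
    have hxs := pointCombination_mem_convexHull (s := (s : Set E)) (hnonneg _ hp) (hnorm _ rfl)
      fun v hv => hps v (hsupp _ _ hv)
    have hxt := pointCombination_mem_convexHull (s := (t : Set E)) (hnonneg _ hn)
      (hnorm _ hsum.symm) fun v hv => hnt v (hsupp _ _ hv)
    have hxeq : pointCombination V (m⁻¹ • w⁺) = pointCombination V (m⁻¹ • w⁻) := by
      rw [map_smul, map_smul, hcomb]
    have hxst := L.inter_subset_convexHull hs ht ⟨hxs, hxeq ▸ hxt⟩
    rw [← Finset.coe_inter] at hxst
    obtain ⟨a, -, ha₁, hast, hax⟩ :=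
      exists_weights_of_mem_convexHull (Finset.inter_subset_left.trans (hV s hs)) hxst
    have eq1 : m⁻¹ • w⁺ - a = 0 := by
      refine eq_zero_of_pointCombination_eq_zero (L.indep hs) (fun v hv => ?_) ?_ ?_
      · by_contra hvs
        have h1 : w⁺ v = 0 := by_contra fun h' => hvs (hps v h')
        have h2 : a v = 0 := by_contra fun h' => hvs (Finset.mem_inter.1 (hast v h')).1
        exact hv (by simp only [Pi.sub_apply, Pi.smul_apply, h1, h2, smul_zero, sub_zero])
      · simp only [Pi.sub_apply, Finset.sum_sub_distrib, hnorm _ rfl, ha₁, sub_self]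
      · rw [map_sub, hax, sub_self]
    have eq2 : m⁻¹ • w⁻ - a = 0 := by
      refine eq_zero_of_pointCombination_eq_zero (L.indep ht) (fun v hv => ?_) ?_ ?_
      · by_contra hvs
        have h1 : w⁻ v = 0 := by_contra fun h' => hvs (hnt v h')
        have h2 : a v = 0 := by_contra fun h' => hvs (Finset.mem_inter.1 (hast v h')).2
        exact hv (by simp only [Pi.sub_apply, Pi.smul_apply, h1, h2, smul_zero, sub_zero])
      · simp only [Pi.sub_apply, Finset.sum_sub_distrib, hnorm _ hsum.symm, ha₁, sub_self]
      · rw [map_sub, hax, hxeq, sub_self]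
    have eq3 : m⁻¹ • w⁺ = m⁻¹ • w⁻ := (sub_eq_zero.1 eq1).trans (sub_eq_zero.1 eq2).symm
    rw [hw, smul_right_injective _ (inv_ne_zero hmpos.ne') eq3, sub_self]

/-- Barycentric coordinates on a finite simplicial complex are Lipschitz. -/
lemma exists_norm_sub_le_pointCombination {L : SimplicialComplex ℝ E} (hL : L.faces.Finite)
    {V : Finset E} (hV : ∀ s ∈ L.faces, s ⊆ V) :
    ∃ C : ℝ, 0 < C ∧ ∀ a ∈ barycentricWeights L V, ∀ b ∈ barycentricWeights L V,
      ‖a - b‖ ≤ C * ‖pointCombination V a - pointCombination V b‖ := by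
  set S : Set (V → ℝ) := ⋃ s ∈ L.faces, ⋃ t ∈ L.faces,
    {w | ∑ v, w v = 0 ∧ ∀ v : V, ((v : E) ∉ s → w v ≤ 0) ∧ ((v : E) ∉ t → 0 ≤ w v)} with hS
  have hSclosed : IsClosed S := by
    refine hL.isClosed_biUnion fun s _ => hL.isClosed_biUnion fun t _ => ?_
    simp only [Set.ofPred_and, Set.ofPred_forall]
    refine (isClosed_eq (by fun_prop) continuous_const).inter (isClosed_iInter fun v => ?_)
    exact (isClosed_iInter fun _ => isClosed_le (by fun_prop) continuous_const).inter
      (isClosed_iInter fun _ => isClosed_le continuous_const (by fun_prop))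
  have hcont : Continuous (pointCombination V) := LinearMap.continuous_of_finiteDimensional _
  obtain ⟨c, hc, hmin⟩ := ((isCompact_sphere (0 : V → ℝ) 1).inter_left hSclosed).exists_forall_le'
    (f := fun w => ‖pointCombination V w‖) hcont.norm.continuousOn (a := 0) (by
      rintro w ⟨hwS, hw1⟩
      rw [norm_pos_iff]
      intro h0
      simp only [hS, Set.mem_iUnion] at hwS
      obtain ⟨s, hs, t, ht, hsum, hw⟩ := hwS
      have := eq_zero_of_pointCombination_eq_zero_of_faces hV hs ht
        (fun v hv => by_contra fun h' => hv.not_ge ((hw v).1 h'))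
        (fun v hv => by_contra fun h' => hv.not_ge ((hw v).2 h')) hsum h0
      simp [this] at hw1)
  refine ⟨c⁻¹, inv_pos.2 hc, fun a ha b hb => ?_⟩
  rw [← map_sub]
  obtain ⟨ha₀, ha₁, s, hs, has⟩ := ha
  obtain ⟨hb₀, hb₁, t, ht, hbt⟩ := hb
  set w := a - b with hw
  rcases eq_or_ne w 0 with h0 | h0
  · simp [h0]
  have hpos : 0 < ‖w‖ := norm_pos_iff.2 h0
  have hwS : ‖w‖⁻¹ • w ∈ S := by
    simp only [hS, Set.mem_iUnion]
    refine ⟨s, hs, t, ht, ?_, fun v => ⟨fun hv => ?_, fun hv => ?_⟩⟩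
    · simp only [hw, Pi.smul_apply, Pi.sub_apply, smul_eq_mul, ← Finset.mul_sum,
        Finset.sum_sub_distrib, ha₁, hb₁, sub_self, mul_zero]
    · have : a v = 0 := by_contra fun h' => hv (has v h')
      refine mul_nonpos_of_nonneg_of_nonpos (inv_nonneg.2 hpos.le) ?_
      simp [hw, this, hb₀]
    · have : b v = 0 := by_contra fun h' => hv (hbt v h')
      refine mul_nonneg (inv_nonneg.2 hpos.le) ?_
      simp [hw, this, ha₀]
  have := hmin _ ⟨hwS, by simp [norm_smul, hpos.ne']⟩
  rw [map_smul, norm_smul, norm_inv, norm_norm, ← div_eq_inv_mul, le_div_iff₀ hpos] at this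
  rwa [← div_eq_inv_mul, le_div_iff₀ hc, mul_comm]

end BarycentricCoordinates

section LipschitzFunctions

variable {Z : Type*} [PseudoMetricSpace Z]

/-- A real function is Lipschitz for some constant. -/
def IsLipschitzFunction (f : Z → ℝ) : Prop := ∃ K, LipschitzWith K f

namespace IsLipschitzFunction

variable {f g : Z → ℝ}

lemma of_le {C : ℝ} (h : ∀ x y, |f x - f y| ≤ C * dist x y) : IsLipschitzFunction f :=
  ⟨_, LipschitzWith.of_dist_le' h⟩

lemma add (hf : IsLipschitzFunction f) (hg : IsLipschitzFunction g) :
    IsLipschitzFunction fun z => f z + g z :=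
  ⟨_, hf.choose_spec.add hg.choose_spec⟩

lemma sub (hf : IsLipschitzFunction f) (hg : IsLipschitzFunction g) :
    IsLipschitzFunction fun z => f z - g z :=
  ⟨_, hf.choose_spec.sub hg.choose_spec⟩

lemma const (c : ℝ) : IsLipschitzFunction fun _ : Z => c :=
  ⟨0, LipschitzWith.const c⟩

lemma sum {ι : Type*} (s : Finset ι) {f : ι → Z → ℝ} (hf : ∀ i, IsLipschitzFunction (f i)) :
    IsLipschitzFunction fun z => ∑ i ∈ s, f i z := by
  classical
  induction s using Finset.induction_on with
  | empty => simpa using const 0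
  | insert i s hi ih => simpa only [Finset.sum_insert hi] using (hf i).add ih

lemma max_zero (hf : IsLipschitzFunction f) : IsLipschitzFunction fun z => max (f z) 0 :=
  ⟨_, hf.choose_spec.max_const 0⟩

lemma exists_abs_le [CompactSpace Z] (hf : IsLipschitzFunction f) :
    ∃ C : ℝ, 0 ≤ C ∧ ∀ z, |f z| ≤ C := by
  obtain ⟨C, hC⟩ := isCompact_univ.exists_bound_of_continuousOn
    hf.choose_spec.continuous.continuousOn
  exact ⟨max C 0, le_max_right _ _, fun z => (hC z (Set.mem_univ z)).trans (le_max_left _ _)⟩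

lemma mul [CompactSpace Z] (hf : IsLipschitzFunction f) (hg : IsLipschitzFunction g) :
    IsLipschitzFunction fun z => f z * g z := by
  obtain ⟨A, hA0, hA⟩ := hf.exists_abs_le
  obtain ⟨B, hB0, hB⟩ := hg.exists_abs_le
  obtain ⟨K, hK⟩ := hf
  obtain ⟨K', hK'⟩ := hg
  refine of_le (C := A * K' + B * K) fun x y => ?_
  have h1 : |f x - f y| ≤ K * dist x y := hK.dist_le_mul x y
  have h2 : |g x - g y| ≤ K' * dist x y := hK'.dist_le_mul x y
  calc |f x * g x - f y * g y| = |f x * (g x - g y) + g y * (f x - f y)| := by ring_nf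
    _ ≤ |f x| * |g x - g y| + |g y| * |f x - f y| := by
      rw [← abs_mul, ← abs_mul]
      exact abs_add_le _ _
    _ ≤ A * (K' * dist x y) + B * (K * dist x y) := by
      gcongr
      exacts [hA x, hB y]
    _ = _ := by ring

lemma inv {c : ℝ} (hc : 0 < c) (hf : IsLipschitzFunction f) (h : ∀ z, c ≤ f z) :
    IsLipschitzFunction fun z => (f z)⁻¹ := by
  obtain ⟨K, hK⟩ := hf
  refine of_le (C := K / (c * c)) fun x y => ?_
  have hx := hc.trans_le (h x)
  have hy := hc.trans_le (h y)
  have h1 : |f y - f x| ≤ K * dist x y := dist_comm x y ▸ hK.dist_le_mul y x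
  rw [inv_sub_inv hx.ne' hy.ne', abs_div, abs_of_pos (mul_pos hx hy), div_mul_eq_mul_div]
  gcongr
  exacts [h x, h y]

end IsLipschitzFunction

/-- Continuous functions on a compact space are uniform limits of Lipschitz functions. -/
lemma exists_isLipschitzFunction_approx [CompactSpace Z] {f : Z → ℝ} (hf : Continuous f)
    {ε : ℝ} (hε : 0 < ε) : ∃ g : Z → ℝ, IsLipschitzFunction g ∧ ∀ z, |g z - f z| ≤ ε := by
  obtain ⟨B, hB⟩ := isCompact_univ.exists_bound_of_continuousOn hf.continuousOn
  obtain ⟨δ, hδ, hfδ⟩ := Metric.uniformContinuous_iff.1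
    (CompactSpace.uniformContinuous_of_continuous hf) ε hε
  obtain ⟨n, hn0, hn⟩ : ∃ n : ℝ, 0 ≤ n ∧ 2 * B ≤ n * δ := by
    refine ⟨max (2 * B / δ) 0, le_max_right _ _, ?_⟩
    rw [← div_le_iff₀ hδ]
    exact le_max_left _ _
  have hlow : ∀ z w, f z - ε ≤ f w + n * dist z w := fun z w => by
    rcases lt_or_ge (dist z w) δ with h | h
    · have h1 := (abs_lt.1 (hfδ h)).2
      have h2 := mul_nonneg hn0 (dist_nonneg (x := z) (y := w))
      linarith
    · have h1 := abs_le.1 (hB z (Set.mem_univ z))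
      have h2 := abs_le.1 (hB w (Set.mem_univ w))
      have h3 := mul_le_mul_of_nonneg_left h hn0
      linarith [h1.2, h2.1]
  have hbdd : ∀ z, BddBelow (Set.range fun w => f w + n * dist z w) := fun z =>
    ⟨f z - ε, Set.forall_mem_range.2 (hlow z)⟩
  refine ⟨fun z => ⨅ w, (f w + n * dist z w), .of_le (C := n) fun x y => ?_, fun z => ?_⟩
  · have key : ∀ x y, (⨅ w, (f w + n * dist x w)) - n * dist x y ≤ ⨅ w, (f w + n * dist y w) := by
      intro x y
      have : Nonempty Z := ⟨x⟩
      refine le_ciInf fun w => ?_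
      have h1 := ciInf_le (hbdd x) w
      have h2 := mul_le_mul_of_nonneg_left (dist_triangle x y w) hn0
      linarith
    rw [abs_le]
    have h1 := key x y
    have h2 := key y x
    rw [dist_comm y x] at h2
    constructor <;> linarith
  · have : Nonempty Z := ⟨z⟩
    have h1 := ciInf_le (hbdd z) z
    have h2 := le_ciInf (hlow z)
    simp only [dist_self, mul_zero, add_zero] at h1
    rw [abs_le]
    constructor <;> linarith

end LipschitzFunctions

/-- A continuous homotopy between Lipschitz maps from a compact space to a finite simplicial
complex can be replaced by a Lipschitz homotopy. -/
lemma exists_lipschitz_homotopy {E X : Type*} [NormedAddCommGroup E] [NormedSpace ℝ E]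
    [PseudoMetricSpace X] [CompactSpace X] {L : SimplicialComplex ℝ E} (hL : L.faces.Finite)
    {g₀ g₁ : X → L.space} {K₀ K₁ : NNReal} (hg₀ : LipschitzWith K₀ g₀) (hg₁ : LipschitzWith K₁ g₁)
    {F : X × I → L.space} (hF : Continuous F) (hF₀ : ∀ x, F (x, 0) = g₀ x)
    (hF₁ : ∀ x, F (x, 1) = g₁ x) :
    ∃ (H : X × I → L.space) (K : NNReal), LipschitzWith K H ∧ (∀ x, H (x, 0) = g₀ x) ∧
      ∀ x, H (x, 1) = g₁ x := by
  classical
  obtain ⟨V, hV⟩ : ∃ V : Finset E, ∀ s ∈ L.faces, s ⊆ V :=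
    ⟨hL.toFinset.sup id, fun s hs => Finset.le_sup (f := id) (hL.mem_toFinset.2 hs)⟩
  obtain ⟨C, hC0, hC⟩ := exists_norm_sub_le_pointCombination hL hV
  choose b hb hbx using fun y : L.space => exists_barycentricWeights hV y.2
  have hbdist : ∀ y y' v, |b y v - b y' v| ≤ C * dist y y' := fun y y' v => by
    have h1 := hC _ (hb y) _ (hb y')
    rw [hbx, hbx, ← dist_eq_norm (y : E) y'] at h1
    exact (norm_le_pi_norm (b y - b y') v).trans h1
  have hblip : ∀ v, LipschitzWith (Real.toNNReal C) fun y => b y v := fun v =>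
    LipschitzWith.of_dist_le' fun y y' => hbdist y y' v
  -- a reparametrized homotopy, constant near both ends
  set q : I → I := fun t => Set.projIcc 0 1 zero_le_one (3 * (t : ℝ) - 1) with hq
  have hqc : Continuous q := continuous_projIcc.comp (by fun_prop)
  set β : X × I → V → ℝ := fun z => b (F (z.1, q z.2)) with hβ
  have hβc : ∀ v, Continuous fun z => β z v := fun v =>
    (hblip v).continuous.comp (hF.comp (by fun_prop))
  set δ : ℝ := (4 * ((Fintype.card V : ℝ) + 1))⁻¹ with hδ
  have hδ0 : 0 < δ := by positivity
  have hδcard : (Fintype.card V : ℝ) * (2 * δ) ≤ 1 / 2 := by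
    rw [hδ, ← div_eq_mul_inv, ← mul_div_assoc, div_le_iff₀ (by positivity)]
    linarith
  choose G hGlip hG using fun v => exists_isLipschitzFunction_approx (hβc v) hδ0
  have htime : IsLipschitzFunction fun z : X × I => (z.2 : ℝ) :=
    ⟨1, .of_dist_le_mul fun x y => by
      rw [NNReal.coe_one, one_mul]
      exact le_max_right (dist x.1 y.1) (dist x.2 y.2)⟩
  set α₀ : X × I → ℝ := fun z => max (1 - 3 * (z.2 : ℝ)) 0 with hα₀
  set α₁ : X × I → ℝ := fun z => max (3 * (z.2 : ℝ) - 2) 0 with hα₁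
  set φ : X × I → ℝ := fun z => 1 - α₀ z - α₁ z with hφ
  have hα₀lip : IsLipschitzFunction α₀ := ((IsLipschitzFunction.const 1).sub
    ((IsLipschitzFunction.const 3).mul htime)).max_zero
  have hα₁lip : IsLipschitzFunction α₁ := (((IsLipschitzFunction.const 3).mul htime).sub
    (IsLipschitzFunction.const 2)).max_zero
  have hφlip : IsLipschitzFunction φ := ((IsLipschitzFunction.const 1).sub hα₀lip).sub hα₁lip
  have hφ0 : ∀ z, 0 ≤ φ z := fun z => by
    have h0 := z.2.2.1
    have h1 := z.2.2.2
    simp only [hφ, hα₀, hα₁]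
    rcases max_cases (1 - 3 * (z.2 : ℝ)) 0 with h | h <;>
      rcases max_cases (3 * (z.2 : ℝ) - 2) 0 with h' | h' <;> linarith
  have hφ1 : ∀ z, φ z ≤ 1 := fun z => by
    have h0 : 0 ≤ α₀ z := le_max_right _ _
    have h1 : 0 ≤ α₁ z := le_max_right _ _
    simp only [hφ]
    linarith
  have hend₀ : ∀ z v, α₀ z * (b (g₀ z.1) v - β z v) = 0 := fun z v => by
    rcases le_or_gt (1 - 3 * (z.2 : ℝ)) 0 with h | h
    · simp [hα₀, max_eq_right h]
    · have : q z.2 = 0 := Set.projIcc_of_le_left _ (by linarith)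
      simp [hβ, this, hF₀]
  have hend₁ : ∀ z v, α₁ z * (b (g₁ z.1) v - β z v) = 0 := fun z v => by
    rcases le_or_gt (3 * (z.2 : ℝ) - 2) 0 with h | h
    · simp [hα₁, max_eq_right h]
    · have : q z.2 = 1 := Set.projIcc_of_right_le _ (by linarith)
      simp [hβ, this, hF₁]
  -- a Lipschitz approximation in weight space, exact at both ends
  set P : X × I → V → ℝ := fun z v =>
    α₀ z * b (g₀ z.1) v + α₁ z * b (g₁ z.1) v + φ z * G v z with hP
  have hPβ : ∀ z v, |P z v - β z v| ≤ φ z * δ := fun z v => by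
    have : P z v - β z v = φ z * (G v z - β z v) := by
      have h0 := hend₀ z v
      have h1 := hend₁ z v
      simp only [hP, hφ]
      linear_combination h0 + h1
    rw [this, abs_mul, abs_of_nonneg (hφ0 z)]
    exact mul_le_mul_of_nonneg_left (hG v z) (hφ0 z)
  have hPlip : ∀ v, IsLipschitzFunction fun z => P z v := fun v =>
    ((hα₀lip.mul ⟨_, (hblip v).comp (hg₀.comp LipschitzWith.prod_fst)⟩).add
      (hα₁lip.mul ⟨_, (hblip v).comp (hg₁.comp LipschitzWith.prod_fst)⟩)).add
      (hφlip.mul (hGlip v))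
  -- truncation and normalization push it into the complex
  set c : X × I → V → ℝ := fun z v => max (P z v - φ z * δ) 0 with hc
  have hclip : ∀ v, IsLipschitzFunction fun z => c z v := fun v =>
    ((hPlip v).sub (hφlip.mul (.const δ))).max_zero
  have hc0 : ∀ z v, 0 ≤ c z v := fun z v => le_max_right _ _
  have hsum : ∀ z, 1 / 2 ≤ ∑ v, c z v := fun z => by
    have h1 : ∀ v ∈ Finset.univ, β z v - 2 * δ ≤ c z v := fun v _ => by
      have h2 := (abs_le.1 (hPβ z v)).1
      have h3 := mul_le_mul_of_nonneg_right (hφ1 z) hδ0.le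
      have h4 : P z v - φ z * δ ≤ c z v := le_max_left _ _
      linarith
    have h5 := Finset.sum_le_sum h1
    have h6 : ∑ v, β z v = 1 := (hb _).2.1
    rw [Finset.sum_sub_distrib, h6, Finset.sum_const, nsmul_eq_mul, Finset.card_univ] at h5
    linarith
  set h : X × I → V → ℝ := fun z v => c z v * (∑ u, c z u)⁻¹ with hh
  have hhlip : ∀ v, IsLipschitzFunction fun z => h z v := fun v =>
    (hclip v).mul ((IsLipschitzFunction.sum _ hclip).inv one_half_pos hsum)
  have hsum0 : ∀ z, 0 < ∑ v, c z v := fun z => one_half_pos.trans_le (hsum z)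
  have hhmem : ∀ z, h z ∈ barycentricWeights L V := fun z => by
    obtain ⟨s, hs, hβs⟩ := (hb (F (z.1, q z.2))).2.2
    refine ⟨fun v => mul_nonneg (hc0 z v) (inv_nonneg.2 (hsum0 z).le), ?_, s, hs, fun v hv => ?_⟩
    · rw [← Finset.sum_mul, mul_inv_cancel₀ (hsum0 z).ne']
    · refine hβs v fun hβv => hv ?_
      have h1 := (abs_le.1 (hPβ z v)).2
      have h2 : β z v = 0 := hβv
      have h3 : c z v = 0 := max_eq_right (by linarith)
      simp [hh, h3]
  choose K hK using hhlip
  have hlip : LipschitzWith (∑ v, K v) h := .of_dist_le_mul fun x y =>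
    (dist_pi_le_iff (by positivity)).2 fun v => ((hK v).dist_le_mul x y).trans <|
      mul_le_mul_of_nonneg_right
        (NNReal.coe_le_coe.2 (Finset.single_le_sum (fun _ _ => zero_le) (Finset.mem_univ v)))
        dist_nonneg
  have hfix : ∀ z y, φ z = 0 → P z = b y → pointCombination V (h z) = y := fun z y hφz hPz => by
    have h1 : c z = b y := by
      funext v
      simp only [hc, hφz, hPz, zero_mul, sub_zero]
      exact max_eq_left ((hb y).1 v)
    rw [← hbx y]
    congr 1
    funext v
    simp only [hh, h1, (hb y).2.1, inv_one, mul_one]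
  refine ⟨fun z => ⟨pointCombination V (h z), pointCombination_mem_space (hhmem z)⟩, _,
    LipschitzWith.subtype_mk
      ((LinearMap.toContinuousLinearMap (pointCombination V)).lipschitz.comp hlip) _,
    fun x => Subtype.ext ?_, fun x => Subtype.ext ?_⟩
  · refine hfix _ _ (by simp [hφ, hα₀, hα₁]) ?_
    funext v
    simp [hP, hφ, hα₀, hα₁]
  · have hmax : max ((3 : ℝ) - 2) 0 = 1 := by norm_num
    refine hfix _ _ (by simp [hφ, hα₀, hα₁, hmax]) ?_
    funext v
    simp [hP, hφ, hα₀, hα₁, hmax]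

lemma isCompact_simplicialComplex_space {E : Type*} [NormedAddCommGroup E] [NormedSpace ℝ E]
    {K : SimplicialComplex ℝ E} (hK : K.faces.Finite) : IsCompact K.space :=
  hK.isCompact_biUnion fun s _ => s.finite_toSet.isCompact_convexHull ℝ

/-- If `f₀ ≃ f₁` are homotopic continuous maps between (underlying spaces of)
finite geometric simplicial complexes, and `g₀, g₁` are Lipschitz maps homotopic
to `f₀` and `f₁` respectively, then there is a Lipschitz homotopy between
`g₀` and `g₁`. -/
theorem lipschitz_homotopy_between_lipschitz_representatives {N M : ℕ}
    (K : SimplicialComplex ℝ (EuclideanSpace ℝ (Fin N)))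
    (L : SimplicialComplex ℝ (EuclideanSpace ℝ (Fin M)))
    (hKfin : K.faces.Finite) (hLfin : L.faces.Finite)
    (f₀ f₁ g₀ g₁ : K.space → L.space)
    (hf₀ : Continuous f₀) (hf₁ : Continuous f₁)
    (hg₀ : ∃ C : ℝ, 0 < C ∧ ∀ x y : K.space, dist (g₀ x) (g₀ y) ≤ C * dist x y)
    (hg₁ : ∃ C : ℝ, 0 < C ∧ ∀ x y : K.space, dist (g₁ x) (g₁ y) ≤ C * dist x y)
    (hf₀f₁ : ∃ H : K.space × I → L.space, Continuous H ∧
      (∀ x : K.space, H (x, 0) = f₀ x) ∧ (∀ x : K.space, H (x, 1) = f₁ x))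
    (hg₀f₀ : ∃ H : K.space × I → L.space, Continuous H ∧
      (∀ x : K.space, H (x, 0) = g₀ x) ∧ (∀ x : K.space, H (x, 1) = f₀ x))
    (hg₁f₁ : ∃ H : K.space × I → L.space, Continuous H ∧
      (∀ x : K.space, H (x, 0) = g₁ x) ∧ (∀ x : K.space, H (x, 1) = f₁ x)) :
    ∃ H : K.space × I → L.space,
      (∃ C : ℝ, 0 < C ∧ ∀ a b : K.space × I, dist (H a) (H b) ≤ C * dist a b) ∧
      (∀ x : K.space, H (x, 0) = g₀ x) ∧ (∀ x : K.space, H (x, 1) = g₁ x) := by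
  obtain ⟨C₀, -, hC₀⟩ := hg₀
  obtain ⟨C₁, -, hC₁⟩ := hg₁
  obtain ⟨A, hA, hA0, hA1⟩ := hg₀f₀
  obtain ⟨B, hB, hB0, hB1⟩ := hf₀f₁
  obtain ⟨D, hD, hD0, hD1⟩ := hg₁f₁
  have : CompactSpace K.space :=
    isCompact_iff_compactSpace.1 (isCompact_simplicialComplex_space hKfin)
  have hl₀ := LipschitzWith.of_dist_le' hC₀
  have hl₁ := LipschitzWith.of_dist_le' hC₁
  have h₀ : ContinuousMap.Homotopic ⟨g₀, hl₀.continuous⟩ ⟨f₀, hf₀⟩ :=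
    ⟨⟨⟨fun p => A (p.2, p.1), by fun_prop⟩, hA0, hA1⟩⟩
  have h₁ : ContinuousMap.Homotopic ⟨f₀, hf₀⟩ ⟨f₁, hf₁⟩ :=
    ⟨⟨⟨fun p => B (p.2, p.1), by fun_prop⟩, hB0, hB1⟩⟩
  have h₂ : ContinuousMap.Homotopic ⟨g₁, hl₁.continuous⟩ ⟨f₁, hf₁⟩ :=
    ⟨⟨⟨fun p => D (p.2, p.1), by fun_prop⟩, hD0, hD1⟩⟩
  obtain ⟨F⟩ := (h₀.trans h₁).trans h₂.symm
  obtain ⟨H, C, hC, hH0, hH1⟩ := exists_lipschitz_homotopy hLfin hl₀ hl₁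
    (F := fun z => F (z.2, z.1)) (by fun_prop) (fun x => F.apply_zero x) (fun x => F.apply_one x)
  refine ⟨H, ⟨C + 1, by positivity, fun a b => (hC.dist_le_mul a b).trans ?_⟩, hH0, hH1⟩
  gcongr
  linarith
end

section
/- Let X ⊆ ℝ^N be a set with ‖x‖ ≤ C for all x ∈ X, where C > 0. Then for all x, y ∈ X, all h, r ≥ 0 and all t with 0 ≤ t ≤ min(h, r), one has ‖(tx, t) − (ty, t)‖ ≤ (C + 2) · ‖(hx, h) − (ry, r)‖, where the points are taken in ℝ^N × ℝ with the Euclidean norm. -/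
/-- Metric estimate in the cone: if `‖x‖ ≤ C` for all `x ∈ X`, then for
`x, y ∈ X`, `h, r ≥ 0` and `0 ≤ t ≤ min h r`,
`‖(t • x, t) − (t • y, t)‖ ≤ (C + 2) ‖(h • x, h) − (r • y, r)‖` in `ℝ^N × ℝ`. -/
theorem cone_metric_estimate {N : ℕ} (X : Set (EuclideanSpace ℝ (Fin N)))
    (C : ℝ) (hC : 0 < C) (hX : ∀ x ∈ X, ‖x‖ ≤ C) :
    ∀ x ∈ X, ∀ y ∈ X, ∀ h r t : ℝ, 0 ≤ h → 0 ≤ r → 0 ≤ t → t ≤ min h r →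
      ‖((t • x, t) : EuclideanSpace ℝ (Fin N) × ℝ) - (t • y, t)‖ ≤
        (C + 2) * ‖((h • x, h) : EuclideanSpace ℝ (Fin N) × ℝ) - (r • y, r)‖ := by
  intro x _ y hy h r t _ _ ht htm
  rw [Prod.mk_sub_mk, Prod.mk_sub_mk, Prod.norm_mk, Prod.norm_mk, sub_self, norm_zero,
    max_eq_left (norm_nonneg _), ← smul_sub, norm_smul, Real.norm_of_nonneg ht]
  set M := max ‖h • x - r • y‖ ‖h - r‖
  have hM₁ : ‖h • x - r • y‖ ≤ M := le_max_left _ _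
  have hM₂ : ‖h - r‖ ≤ M := le_max_right _ _
  have hM : 0 ≤ M := (norm_nonneg _).trans hM₁
  have hh : 0 ≤ h := ht.trans (htm.trans (min_le_left _ _))
  calc t * ‖x - y‖ ≤ h * ‖x - y‖ := by gcongr; exact htm.trans (min_le_left _ _)
    _ = ‖(h • x - r • y) - (h - r) • y‖ := by
      rw [← Real.norm_of_nonneg hh, ← norm_smul, Real.norm_of_nonneg hh]
      congr 1
      module
    _ ≤ ‖h • x - r • y‖ + ‖h - r‖ * ‖y‖ := by
      rw [← norm_smul]
      exact norm_sub_le _ _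
    _ ≤ M + M * C := by
      gcongr
      exact hX y hy
    _ ≤ (C + 2) * M := by linarith
end

section
/- The maps f, g : ℝ₊ → ℝ defined by f(t) = t and g(t) = −t are coarse maps that are not coarsely homotopic. -/
open scoped NNReal

lemma Isometry.isCoarseMap {X Y : Type*} [PseudoMetricSpace X] [PseudoMetricSpace Y]
    {f : X → Y} (hf : Isometry f) : IsCoarseMap f :=
  ⟨fun R hR => ⟨R, hR, fun x y h => (hf.dist_eq x y).trans_le h⟩,
    fun _ hB => hf.antilipschitz.isBounded_preimage hB⟩

/-- A real sequence with steps of size at most `S` that starts above `S` and avoids `[-S, S]`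
stays above `S`. -/
lemma lt_of_dist_succ_le_of_lt_abs {u : ℕ → ℝ} {S : ℝ} (h₀ : S < u 0)
    (hstep : ∀ n, dist (u n) (u (n + 1)) ≤ S) (habs : ∀ n, S < |u n|) (n : ℕ) : S < u n := by
  induction n with
  | zero => exact h₀
  | succ n ih =>
    have hle := (abs_le.mp (Real.dist_eq _ _ ▸ hstep n)).2
    rcases lt_abs.mp (habs (n + 1)) with h | h
    · exact h
    · have hS : 0 ≤ S := dist_nonneg.trans (hstep n)
      linarith

/-- The maps `t ↦ t` and `t ↦ -t` from `ℝ₊` to `ℝ` are coarse but not coarsely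
homotopic (`π₀^coarse(ℝ)` has two elements). -/
theorem rays_in_line_not_coarsely_homotopic :
    IsCoarseMap (fun t : ℝ≥0 => (t : ℝ)) ∧
    IsCoarseMap (fun t : ℝ≥0 => -(t : ℝ)) ∧
    ¬ CoarseHomotopic (fun t : ℝ≥0 => (t : ℝ)) (fun t : ℝ≥0 => -(t : ℝ)) := by
  refine ⟨isometry_subtype_coe.isCoarseMap,
    ((IsometryEquiv.neg ℝ).isometry.comp isometry_subtype_coe).isCoarseMap, ?_⟩
  rintro ⟨p, -, H, ⟨hcontrolled, hproper⟩, hzero, hone⟩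
  obtain ⟨S, hS, hstep⟩ := hcontrolled 1 one_pos
  obtain ⟨K, hK⟩ :=
    (hproper _ (Metric.isBounded_closedBall (x := (0 : ℝ)) (r := S))).subset_closedBall
      ⟨(0, 0), by simp [cylSet]⟩
  obtain ⟨x, hx⟩ : ∃ x : ℝ≥0, max S K < x :=
    ⟨⟨max S K + 1, by positivity⟩, lt_add_one (max S K)⟩
  have hxS : S < x := (le_max_left S K).trans_lt hx
  have hxK : K < x := (le_max_right S K).trans_lt hx
  let z (n : ℕ) : cylSet p := ⟨(x, min (n : ℝ≥0) (p x + 1)), by simp [cylSet]⟩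
  have hz (n : ℕ) : dist (z n) (z (n + 1)) ≤ 1 := by
    refine max_le (by simp [z]) ?_
    change |((min (n : ℝ≥0) (p x + 1) : ℝ≥0) : ℝ) - (min ((n + 1 : ℕ) : ℝ≥0) (p x + 1) : ℝ≥0)| ≤ 1
    push_cast
    refine (abs_min_sub_min_le_max _ _ _ _).trans (by simp)
  have habs (n : ℕ) : S < |H (z n)| := by
    by_contra! h
    have hdist : dist (z n) _ ≤ K := hK (by simpa using h : z n ∈ H ⁻¹' Metric.closedBall 0 S)
    have hle : dist x 0 ≤ K := (le_max_left _ _).trans hdist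
    rw [NNReal.dist_eq, NNReal.coe_zero, sub_zero, NNReal.abs_eq] at hle
    exact hle.not_gt hxK
  have hpos := lt_of_dist_succ_le_of_lt_abs (u := fun n => H (z n))
    (by simpa [z, hzero] using hxS) (fun n => hstep _ _ (hz n)) habs
  obtain ⟨N, hN⟩ := exists_nat_ge (p x + 1)
  have hend : S < H (z N) := hpos N
  simp only [z, min_eq_right hN, hone] at hend
  linarith
end
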